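/- arXiv:2307.01374 — 3 statements merged into one kernel-verified Lean document; each statement's English description precedes it below -/
import Mathlib

section
/- Let F be an L-intersecting, n-uniform set family for L = {ℓ_1, ..., ℓ_s} with 0 ≤ ℓ_1 < ℓ_2 < ... < ℓ_s < n and s ≥ 1. Let m = max{r-1, n² - n + 1}. If |F| > n! · m^s / ((ℓ_1+1)! (ℓ_2-ℓ_1)! (ℓ_3-ℓ_2)! ··· (ℓ_s-ℓ_{s-1})! (n-ℓ_s-1)!), then F contains an r-sunflower. -/
def HasSunflower {α : Type*} [DecidableEq α] (F : Finset (Finset α)) (r : ℕ) : Prop :=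
  ∃ P ⊆ F, P.card = r ∧ ∃ K : Finset α, ∀ A ∈ P, ∀ B ∈ P, A ≠ B → A ∩ B = K

theorem deza_key {α : Type*} [DecidableEq α] (k l : ℕ) (G : Finset (Finset α))
    (hu : ∀ A ∈ G, A.card = k + l)
    (hl : ∀ A ∈ G, ∀ B ∈ G, A ≠ B → (A ∩ B).card = l) (x : α)
    (a b : ℕ) (ha : a = (G.filter (fun A => x ∈ A)).card)
    (hb : b = (G.filter (fun A => x ∉ A)).card) (hapos : 0 < a) (hk : 0 < k) :
    ((k : ℤ) + l * b) * ((a : ℤ) - k) ≤ k * l * a := by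
  set p : ℤ := (k : ℤ) + l * b with hp
  set q : ℤ := -((l : ℤ) * a) with hq
  set w : Finset α → ℤ := fun A => if x ∈ A then p else q with hw
  set U : Finset α := G.biUnion id with hU
  have hsum1 : ∑ A ∈ G, w A = a * p + b * q := by
    simp only [hw]
    rw [Finset.sum_ite, Finset.sum_const, Finset.sum_const, ← ha, ← hb]
    simp
  have hsum2 : ∑ A ∈ G, w A * w A = a * (p * p) + b * (q * q) := by
    have : ∀ A ∈ G, w A * w A = if x ∈ A then p * p else q * q := by
      intro A _
      simp only [hw]
      split_ifs <;> rfl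
    rw [Finset.sum_congr rfl this, Finset.sum_ite, Finset.sum_const, Finset.sum_const, ← ha, ← hb]
    simp
  have hxU : x ∈ U := by
    rw [ha, Finset.card_pos] at hapos
    obtain ⟨A, hA⟩ := hapos
    rw [Finset.mem_filter] at hA
    rw [hU, Finset.mem_biUnion]
    exact ⟨A, hA.1, hA.2⟩
  have hmain : ∑ y ∈ U, (∑ A ∈ G, if y ∈ A then w A else 0) ^ 2
      = l * (a * p + b * q) ^ 2 + k * (a * (p * p) + b * (q * q)) := by
    have h1 : ∀ y ∈ U, (∑ A ∈ G, if y ∈ A then w A else 0) ^ 2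
        = ∑ A ∈ G, ∑ B ∈ G, if y ∈ A ∩ B then w A * w B else 0 := by
      intro y _
      rw [sq, Finset.sum_mul_sum]
      refine Finset.sum_congr rfl fun A _ => Finset.sum_congr rfl fun B _ => ?_
      simp only [Finset.mem_inter]
      split_ifs <;> simp_all
    rw [Finset.sum_congr rfl h1, Finset.sum_comm]
    have h2 : ∀ A ∈ G, ∑ y ∈ U, ∑ B ∈ G, (if y ∈ A ∩ B then w A * w B else 0)
        = l * (w A * ∑ B ∈ G, w B) + k * (w A * w A) := by
      intro A hA
      rw [Finset.sum_comm]
      have h3 : ∀ B ∈ G, ∑ y ∈ U, (if y ∈ A ∩ B then w A * w B else 0)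
          = l * (w A * w B) + if A = B then k * (w A * w B) else 0 := by
        intro B hB
        rw [← Finset.sum_filter, Finset.sum_const]
        have h4 : U.filter (fun y => y ∈ A ∩ B) = A ∩ B := by
          ext y
          simp only [Finset.mem_filter, hU, Finset.mem_biUnion, Finset.mem_inter, id]
          exact ⟨fun h => h.2, fun h => ⟨⟨A, hA, h.1⟩, h⟩⟩
        rw [h4]
        split_ifs with hAB
        · subst hAB
          rw [Finset.inter_self, hu A hA]
          simp only [nsmul_eq_mul]
          push_cast
          ring
        · rw [hl A hA B hB hAB]
          simp
      rw [Finset.sum_congr rfl h3, Finset.sum_add_distrib, Finset.sum_ite_eq, if_pos hA,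
        Finset.mul_sum, Finset.mul_sum]
    rw [Finset.sum_congr rfl h2, Finset.sum_add_distrib, ← Finset.mul_sum, ← Finset.mul_sum,
      ← Finset.sum_mul, hsum1, hsum2]
    ring
  have hx : (∑ A ∈ G, if x ∈ A then w A else 0) = a * p := by
    rw [← Finset.sum_filter]
    have : ∀ A ∈ G.filter (fun A => x ∈ A), w A = p := by
      intro A hA
      simp only [hw]
      rw [if_pos (Finset.mem_filter.1 hA).2]
    rw [Finset.sum_congr rfl this, Finset.sum_const, ← ha]
    simp
  have hle := Finset.single_le_sum (f := fun y => (∑ A ∈ G, if y ∈ A then w A else 0) ^ 2)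
    (fun y _ => sq_nonneg _) hxU
  simp only [hmain, hx] at hle
  have hpp : 0 < p := by rw [hp]; positivity
  have hap : (0 : ℤ) < a := by exact_mod_cast hapos
  have e1 : (a : ℤ) * p + b * q = k * a := by rw [hp, hq]; ring
  rw [e1] at hle
  have e2 : (l : ℤ) * (k * a) ^ 2 + k * (a * (p * p) + b * (q * q)) - (a * p) ^ 2
      = (a * p) * (k * l * a - p * (a - k)) := by
    rw [hp, hq]; ring
  have e3 : 0 ≤ ((a : ℤ) * p) * (k * l * a - p * (a - k)) := by linarith
  have := nonneg_of_mul_nonneg_right e3 (by positivity)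
  linarith

theorem deza {α : Type*} [DecidableEq α] (k l : ℕ) (hk : 0 < k) (hl0 : 0 < l)
    (G : Finset (Finset α)) (hu : ∀ A ∈ G, A.card = k + l)
    (hl : ∀ A ∈ G, ∀ B ∈ G, A ≠ B → (A ∩ B).card = l)
    (hG : (k + l) * (k + l - 1) + 2 ≤ G.card) :
    ∃ K : Finset α, ∀ A ∈ G, ∀ B ∈ G, A ≠ B → A ∩ B = K := by
  obtain ⟨l', rfl⟩ : ∃ l', l = l' + 1 := ⟨l - 1, by omega⟩
  have hG' : (k + l' + 1) * (k + l') + 2 ≤ G.card := by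
    simpa [← add_assoc] using hG
  have hkk : 1 ≤ k := hk
  set d : α → ℕ := fun x => (G.filter (fun A => x ∈ A)).card with hd
  set e : α → ℕ := fun x => (G.filter (fun A => x ∉ A)).card with he
  have hde : ∀ x, d x + e x = G.card := fun x => Finset.card_filter_add_card_filter_not _
  have hdich : ∀ x, d x ≤ k ∨ e x ≤ k := by
    intro x
    by_contra! hcon
    obtain ⟨h1, h2⟩ := hcon
    have key := deza_key k (l' + 1) G hu hl x (d x) (e x) rfl rfl (by omega) hk
    obtain ⟨i, hi⟩ : ∃ i, d x = k + 1 + i := ⟨d x - (k + 1), by omega⟩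
    obtain ⟨j, hj⟩ : ∃ j, e x = k + 1 + j := ⟨e x - (k + 1), by omega⟩
    have hs := hde x
    rw [hi, hj] at key hs
    have hs2 : (k + l' + 1) * (k + l') ≤ 2 * k + i + j := by omega
    push_cast at key
    zify at hs2 hk
    have hi0 : (0 : ℤ) ≤ i := by positivity
    have hj0 : (0 : ℤ) ≤ j := by positivity
    have hl0 : (0 : ℤ) ≤ l' := by positivity
    -- k (i+1) + l (i+1)(j+1) ≤ l k^2
    have key2 : (k : ℤ) * (i + 1) + (l' + 1) * ((i + 1) * (j + 1)) ≤ (l' + 1) * (k * k) := by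
      nlinarith
    have h5 : (i : ℤ) + j + 1 ≤ (i + 1) * (j + 1) := by nlinarith
    have h6 : (l' + 1 : ℤ) * (i + j + 1) ≤ (l' + 1) * ((i + 1) * (j + 1)) :=
      mul_le_mul_of_nonneg_left h5 (by positivity)
    have h7 : (l' + 1 : ℤ) * ((k + l' + 1) * (k + l')) ≤ (l' + 1) * (2 * k + i + j) :=
      mul_le_mul_of_nonneg_left hs2 (by positivity)
    have h8 : (k : ℤ) ≤ k * (i + 1) := by nlinarith
    have h9 : (0 : ℤ) ≤ l' * k := by positivity
    have h10 : (0 : ℤ) ≤ l' * l' * k := by positivity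
    have h11 : (0 : ℤ) ≤ l' * l' * l' := by positivity
    have h12 : (0 : ℤ) ≤ l' * l' := by positivity
    nlinarith
  -- each set contains at least l dominant elements
  have hdom : ∀ A ∈ G, l' + 1 ≤ (A.filter (fun x => e x ≤ k)).card := by
    intro A hA
    by_contra! hcon
    have hsum : ∑ x ∈ A, d x = G.card * (l' + 1) + k := by
      have : ∑ x ∈ A, d x = ∑ B ∈ G, (A ∩ B).card := by
        simp only [hd, Finset.card_filter]
        rw [Finset.sum_comm]
        refine Finset.sum_congr rfl fun B _ => ?_
        rw [← Finset.card_filter, Finset.filter_mem_eq_inter]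
      rw [this]
      have h3 : ∀ B ∈ G, (A ∩ B).card = (l' + 1) + if A = B then k else 0 := by
        intro B hB
        split_ifs with h
        · subst h
          rw [Finset.inter_self, hu A hA]; ring
        · rw [hl A hA B hB h]
      rw [Finset.sum_congr rfl h3, Finset.sum_add_distrib, Finset.sum_ite_eq, if_pos hA]
      simp
    have hbd : ∑ x ∈ A, d x ≤ (A.filter (fun x => e x ≤ k)).card * G.card
        + (A.filter (fun x => ¬ e x ≤ k)).card * k := by
      rw [← Finset.sum_filter_add_sum_filter_not A (fun x => e x ≤ k)]
      refine add_le_add ?_ ?_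
      · refine Finset.sum_le_card_nsmul _ _ _ fun x _ => ?_
        have := hde x
        omega
      · refine Finset.sum_le_card_nsmul _ _ _ fun x hx => ?_
        rcases hdich x with h | h
        · exact h
        · exact absurd h (Finset.mem_filter.1 hx).2
    have hc : (A.filter (fun x => e x ≤ k)).card + (A.filter (fun x => ¬ e x ≤ k)).card
        = k + (l' + 1) := by
      rw [Finset.card_filter_add_card_filter_not, hu A hA]
    set t := (A.filter (fun x => e x ≤ k)).card
    set t' := (A.filter (fun x => ¬ e x ≤ k)).card
    obtain ⟨u, hu'⟩ : ∃ u, l' = t + u := ⟨l' - t, by omega⟩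
    have ht' : t' = k + 1 + u := by omega
    rw [hsum, ht', hu'] at hbd
    rw [hu'] at hG'
    have h1 : (u + 1) * G.card + k ≤ (k + 1 + u) * k := by nlinarith
    have h2 : (u + 1) * ((k + (t + u) + 1) * (k + (t + u)) + 2) ≤ (u + 1) * G.card :=
      Nat.mul_le_mul_left _ hG'
    have h3 : (k + 1) * k + 2 ≤ (k + (t + u) + 1) * (k + (t + u)) + 2 := by
      gcongr <;> omega
    have h4 := Nat.mul_le_mul_left (u + 1) h3
    nlinarith [Nat.zero_le (u * k * k)]
  -- any set of dominant elements has at most l elements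
  have hfew : ∀ S : Finset α, (∀ x ∈ S, e x ≤ k) → S.card ≤ l' + 1 := by
    intro S hS
    by_contra! hcon
    obtain ⟨T, hTS, hT⟩ := Finset.exists_subset_card_eq (show l' + 2 ≤ S.card by omega)
    have hbad : (G.filter (fun A => ¬ T ⊆ A)).card ≤ (l' + 2) * k := by
      have hsub : G.filter (fun A => ¬ T ⊆ A) ⊆
          T.biUnion (fun x => G.filter (fun A => x ∉ A)) := by
        intro A hA
        rw [Finset.mem_filter, Finset.not_subset] at hA
        obtain ⟨hA, x, hxT, hxA⟩ := hA
        rw [Finset.mem_biUnion]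
        exact ⟨x, hxT, Finset.mem_filter.2 ⟨hA, hxA⟩⟩
      refine (Finset.card_le_card hsub).trans ?_
      rw [← hT]
      exact Finset.card_biUnion_le_card_mul _ _ _ fun x hx => hS x (hTS hx)
    have hgood := Finset.card_filter_add_card_filter_not (s := G) (fun A => T ⊆ A)
    have h2 : 1 < (G.filter (fun A => T ⊆ A)).card := by
      have : (l' + 2) * k ≤ (k + l' + 1) * (k + l') :=
        Nat.mul_le_mul (by omega) (by omega)
      omega
    obtain ⟨A, hA, B, hB, hAB⟩ := Finset.one_lt_card.1 h2
    rw [Finset.mem_filter] at hA hB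
    have h3 := hl A hA.1 B hB.1 hAB
    have h4 := Finset.card_le_card (Finset.subset_inter hA.2 hB.2)
    omega
  have huniq : ∀ A ∈ G, ∀ B ∈ G,
      A.filter (fun x => e x ≤ k) ⊆ B.filter (fun x => e x ≤ k) := by
    intro A hA B hB
    have h1 := hfew (A.filter (fun x => e x ≤ k) ∪ B.filter (fun x => e x ≤ k)) (by
      intro x hx
      rw [Finset.mem_union, Finset.mem_filter, Finset.mem_filter] at hx
      tauto)
    have h2 := hdom B hB
    have h3 := Finset.eq_of_subset_of_card_le
      (Finset.subset_union_right (s₁ := A.filter (fun x => e x ≤ k))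
        (s₂ := B.filter (fun x => e x ≤ k))) (by omega)
    rw [h3]
    exact Finset.subset_union_left
  obtain ⟨A₀, hA₀⟩ : G.Nonempty := Finset.card_pos.1 (by omega)
  refine ⟨A₀.filter (fun x => e x ≤ k), fun A hA B hB hAB => ?_⟩
  symm
  refine Finset.eq_of_subset_of_card_le (Finset.subset_inter ?_ ?_) ?_
  · exact (huniq A₀ hA₀ A hA).trans (Finset.filter_subset _ _)
  · exact (huniq A₀ hA₀ B hB).trans (Finset.filter_subset _ _)
  · rw [hl A hA B hB hAB]
    exact hdom A₀ hA₀

/-- A family with constant intersection size and no r-sunflower is small. -/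
theorem const_inter_card_le {α : Type*} [DecidableEq α] (n r l m : ℕ) (hln : l < n)
    (hr : r ≤ m + 1) (hm : n * (n - 1) + 1 ≤ m) (F G : Finset (Finset α)) (hGF : G ⊆ F)
    (hu : ∀ A ∈ G, A.card = n)
    (hl : ∀ A ∈ G, ∀ B ∈ G, A ≠ B → (A ∩ B).card = l)
    (hS : ¬ HasSunflower F r) : G.card ≤ m := by
  by_contra! hcon
  apply hS
  have hK : ∃ K : Finset α, ∀ A ∈ G, ∀ B ∈ G, A ≠ B → A ∩ B = K := by
    rcases Nat.eq_zero_or_pos l with h0 | h0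
    · refine ⟨∅, fun A hA B hB hAB => ?_⟩
      rw [← Finset.card_eq_zero, hl A hA B hB hAB, h0]
    · obtain ⟨k, rfl⟩ : ∃ k, n = k + l := ⟨n - l, by omega⟩
      exact deza k l (by omega) h0 G hu hl (by omega)
  obtain ⟨K, hK⟩ := hK
  obtain ⟨P, hPG, hP⟩ := Finset.exists_subset_card_eq (show r ≤ G.card by omega)
  exact ⟨P, hPG.trans hGF, hP, K, fun A hA B hB hAB => hK A (hPG hA) B (hPG hB) hAB⟩

theorem sunflower_aux {α : Type*} [DecidableEq α] (r m : ℕ) (hr : r ≤ m + 1) (s : ℕ) :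
    ∀ (n : ℕ) (ℓ : Fin (s + 1) → ℕ) (_ : StrictMono ℓ) (_ : ℓ (Fin.last s) < n)
    (_ : n * (n - 1) + 1 ≤ m)
    (F : Finset (Finset α)) (_ : ∀ A ∈ F, A.card = n)
    (_ : ∀ A ∈ F, ∀ B ∈ F, A ≠ B → ∃ i : Fin (s + 1), (A ∩ B).card = ℓ i)
    (_ : ¬ HasSunflower F r),
    F.card * ((ℓ 0 + 1).factorial *
        (∏ i : Fin s, (ℓ i.succ - ℓ i.castSucc).factorial) *
        (n - ℓ (Fin.last s) - 1).factorial) ≤ n.factorial * m ^ (s + 1) := by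
  induction s with
  | zero =>
    intro n ℓ hmono hlast hm F hu hL hS
    have h1 : F.card ≤ m := by
      refine const_inter_card_le n r (ℓ 0) m hlast hr hm F F subset_rfl hu ?_ hS
      intro A hA B hB hAB
      obtain ⟨i, hi⟩ := hL A hA B hB hAB
      rw [hi, Fin.fin_one_eq_zero i]
    have hlast' : ℓ 0 < n := hlast
    have h2 : (ℓ 0 + 1).factorial * (n - ℓ 0 - 1).factorial ≤ n.factorial := by
      have := Nat.factorial_mul_factorial_dvd_factorial (show ℓ 0 + 1 ≤ n by omega)
      rw [← Nat.sub_sub] at this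
      exact Nat.le_of_dvd (Nat.factorial_pos _) this
    have := Nat.mul_le_mul h1 h2
    simpa [mul_comm] using this
  | succ s ih =>
    intro n ℓ hmono hlast hm F hu hL hS
    have hge : ∀ i : Fin (s + 1), ℓ 0 + 1 ≤ ℓ i.succ := fun i => hmono (Fin.succ_pos i)
    have hn : ℓ 0 + 1 < n := by
      have := hge (Fin.last s)
      have h2 : ℓ (Fin.last s).succ < n := hlast
      omega
    -- maximal subfamily with all intersections of size ℓ 0
    obtain ⟨G, hG, hmax⟩ := Finset.exists_max_image
      (F.powerset.filter fun G => ∀ A ∈ G, ∀ B ∈ G, A ≠ B → (A ∩ B).card = ℓ 0)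
      Finset.card ⟨∅, by simp⟩
    rw [Finset.mem_filter, Finset.mem_powerset] at hG
    obtain ⟨hGF, hGl⟩ := hG
    have hGm : G.card ≤ m := const_inter_card_le n r (ℓ 0) m (by omega) hr hm F G hGF
      (fun A hA => hu A (hGF hA)) hGl hS
    have hcov : ∀ C ∈ F, ∃ A ∈ G, ℓ 0 + 1 ≤ (A ∩ C).card := by
      intro C hC
      by_contra! hcon
      have hCG : C ∉ G := by
        intro h
        have := hcon C h
        rw [Finset.inter_self, hu C hC] at this
        omega
      have hCl : ∀ A ∈ G, (A ∩ C).card = ℓ 0 := by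
        intro A hA
        obtain ⟨i, hi⟩ := hL A (hGF hA) C hC (fun h => hCG (h ▸ hA))
        have h1 := hcon A hA
        have h2 : ℓ 0 ≤ ℓ i := hmono.monotone (Fin.zero_le i)
        omega
      have := hmax (insert C G) (by
        rw [Finset.mem_filter, Finset.mem_powerset]
        refine ⟨Finset.insert_subset hC hGF, ?_⟩
        intro A hA B hB hAB
        rw [Finset.mem_insert] at hA hB
        rcases hA with rfl | hA <;> rcases hB with rfl | hB
        · exact absurd rfl hAB
        · rw [Finset.inter_comm]; exact hCl B hB
        · exact hCl A hA
        · exact hGl A hA B hB hAB)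
      rw [Finset.card_insert_of_notMem hCG] at this
      omega
    set n' := n - (ℓ 0 + 1) with hn'
    set ℓ' : Fin (s + 1) → ℕ := fun i => ℓ i.succ - (ℓ 0 + 1) with hℓ'
    set D' := (ℓ' 0 + 1).factorial *
        (∏ i : Fin s, (ℓ' i.succ - ℓ' i.castSucc).factorial) *
        (n' - ℓ' (Fin.last s) - 1).factorial with hD'
    have hstep : ∀ B : Finset α, B.card = ℓ 0 + 1 →
        (F.filter (fun C => B ⊆ C)).card * D' ≤ n'.factorial * m ^ (s + 1) := by
      intro B hB
      have hinj : Set.InjOn (fun C : Finset α => C \ B) (F.filter (fun C => B ⊆ C)) := by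
        intro C hC C' hC' h
        simp only [Finset.coe_filter, Set.mem_ofPred_eq] at hC hC' h
        rw [← Finset.sdiff_union_of_subset hC.2, h, Finset.sdiff_union_of_subset hC'.2]
      rw [← Finset.card_image_of_injOn hinj]
      have hinter : ∀ C C' : Finset α, (C \ B) ∩ (C' \ B) = (C ∩ C') \ B := by
        intro C C'
        ext y
        simp only [Finset.mem_inter, Finset.mem_sdiff]
        tauto
      refine ih n' ℓ' ?_ ?_ ?_ _ ?_ ?_ ?_
      · intro i j hij
        have h1 := hmono (Fin.succ_lt_succ_iff.2 hij)
        have h2 := hge i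
        simp only [hℓ']
        omega
      · have h1 := hge (Fin.last s)
        have h2 : ℓ (Fin.last s).succ < n := hlast
        simp only [hℓ']
        omega
      · refine le_trans ?_ hm
        have : n' ≤ n := by omega
        gcongr
      · intro A hA
        rw [Finset.mem_image] at hA
        obtain ⟨C, hC, rfl⟩ := hA
        rw [Finset.mem_filter] at hC
        rw [Finset.card_sdiff_of_subset hC.2, hu C hC.1, hB]
      · intro A hA A' hA' hAA
        rw [Finset.mem_image] at hA hA'
        obtain ⟨C, hC, rfl⟩ := hA
        obtain ⟨C', hC', rfl⟩ := hA'
        rw [Finset.mem_filter] at hC hC'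
        have hne : C ≠ C' := fun h => hAA (by rw [h])
        obtain ⟨i, hi⟩ := hL C hC.1 C' hC'.1 hne
        have hsub := Finset.subset_inter hC.2 hC'.2
        have hle := Finset.card_le_card hsub
        rw [hinter, Finset.card_sdiff_of_subset hsub, hi, hB]
        rcases Fin.eq_zero_or_eq_succ i with h | ⟨j, rfl⟩
        · rw [hi, h] at hle
          omega
        · exact ⟨j, rfl⟩
      · rintro ⟨P, hP, hPr, K, hK⟩
        apply hS
        have hPB : ∀ A ∈ P, A ∪ B ∈ F ∧ (A ∪ B) \ B = A := by
          intro A hA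
          have := hP hA
          rw [Finset.mem_image] at this
          obtain ⟨C, hC, rfl⟩ := this
          rw [Finset.mem_filter] at hC
          simp only [Finset.sdiff_union_of_subset hC.2]
          exact ⟨hC.1, trivial⟩
        refine ⟨P.image (fun A => A ∪ B), ?_, ?_, K ∪ B, ?_⟩
        · intro A hA
          rw [Finset.mem_image] at hA
          obtain ⟨C, hC, rfl⟩ := hA
          exact (hPB C hC).1
        · rw [Finset.card_image_of_injOn, hPr]
          intro A hA A' hA' h
          rw [← (hPB A hA).2, ← (hPB A' hA').2]
          simp only at h
          rw [h]
        · intro A hA A' hA' hAA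
          rw [Finset.mem_image] at hA hA'
          obtain ⟨C, hC, rfl⟩ := hA
          obtain ⟨C', hC', rfl⟩ := hA'
          have hne : C ≠ C' := fun h => hAA (by rw [h])
          rw [← hK C hC C' hC' hne, Finset.inter_union_distrib_right]
    -- covering
    have hsub : F ⊆ G.biUnion (fun A => (A.powersetCard (ℓ 0 + 1)).biUnion
        (fun B => F.filter (fun C => B ⊆ C))) := by
      intro C hC
      obtain ⟨A, hA, hAC⟩ := hcov C hC
      obtain ⟨B, hB, hBc⟩ := Finset.exists_subset_card_eq hAC
      rw [Finset.mem_biUnion]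
      refine ⟨A, hA, ?_⟩
      rw [Finset.mem_biUnion]
      refine ⟨B, Finset.mem_powersetCard.2 ⟨hB.trans Finset.inter_subset_left, hBc⟩, ?_⟩
      exact Finset.mem_filter.2 ⟨hC, hB.trans Finset.inter_subset_right⟩
    have hFc : F.card * D' ≤ G.card * (n.choose (ℓ 0 + 1) * (n'.factorial * m ^ (s + 1))) := by
      calc F.card * D' ≤ (∑ A ∈ G, ∑ B ∈ A.powersetCard (ℓ 0 + 1),
            (F.filter (fun C => B ⊆ C)).card) * D' := by
            refine Nat.mul_le_mul_right _ ?_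
            refine (Finset.card_le_card hsub).trans (Finset.card_biUnion_le.trans ?_)
            exact Finset.sum_le_sum fun A _ => Finset.card_biUnion_le
        _ = ∑ A ∈ G, ∑ B ∈ A.powersetCard (ℓ 0 + 1),
            (F.filter (fun C => B ⊆ C)).card * D' := by
            rw [Finset.sum_mul]
            exact Finset.sum_congr rfl fun A _ => Finset.sum_mul _ _ _
        _ ≤ _ := by
            refine Finset.sum_le_card_nsmul _ _ _ fun A hA => ?_
            rw [← hu A (hGF hA), ← Finset.card_powersetCard]
            refine Finset.sum_le_card_nsmul _ _ _ fun B hB => ?_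
            exact hstep B (Finset.mem_powersetCard.1 hB).2
    have hDD : (ℓ 0 + 1).factorial *
        (∏ i : Fin (s + 1), (ℓ i.succ - ℓ i.castSucc).factorial) *
        (n - ℓ (Fin.last (s + 1)) - 1).factorial = (ℓ 0 + 1).factorial * D' := by
      rw [hD', Fin.prod_univ_succ]
      have e1 : ℓ' 0 + 1 = ℓ (Fin.succ 0) - ℓ (Fin.castSucc 0) := by
        have := hge 0
        simp only [hℓ', Fin.castSucc_zero]
        omega
      have e2 : ∀ i : Fin s, ℓ' i.succ - ℓ' i.castSucc
          = ℓ i.succ.succ - ℓ i.succ.castSucc := by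
        intro i
        have h1 := hge i.succ
        have h2 := hge i.castSucc
        simp only [hℓ', ← Fin.succ_castSucc]
        omega
      have e3 : n' - ℓ' (Fin.last s) - 1 = n - ℓ (Fin.last (s + 1)) - 1 := by
        have h1 := hge (Fin.last s)
        have h2 : ℓ (Fin.last (s + 1)) = ℓ (Fin.last s).succ := rfl
        simp only [hℓ', hn', h2]
        omega
      simp only [e1, e2, e3]
      ring
    rw [hDD]
    have hch := Nat.choose_mul_factorial_mul_factorial hn.le
    calc F.card * ((ℓ 0 + 1).factorial * D') = (ℓ 0 + 1).factorial * (F.card * D') := by ring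
      _ ≤ (ℓ 0 + 1).factorial *
          (m * (n.choose (ℓ 0 + 1) * (n'.factorial * m ^ (s + 1)))) := by
          exact Nat.mul_le_mul_left _ (hFc.trans (Nat.mul_le_mul_right _ hGm))
      _ = (n.choose (ℓ 0 + 1) * (ℓ 0 + 1).factorial * n'.factorial) * m ^ (s + 1 + 1) := by ring
      _ = _ := by rw [hch]


/-- main claim for L-intersecting families, L = {ℓ 0, …, ℓ s} with s+1 elements.
The bound |F| > n! m^{s+1} / ((ℓ 0+1)! (ℓ 1-ℓ 0)! ⋯ (ℓ s - ℓ (s-1))! (n-ℓ s-1)!) is stated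
in the cross-multiplied form (the denominator divides the numerator, as it is a multinomial). -/
theorem l_intersecting_sunflower {α : Type*} [DecidableEq α] (n r s : ℕ)
    (ℓ : Fin (s + 1) → ℕ) (hmono : StrictMono ℓ) (hlast : ℓ (Fin.last s) < n)
    (F : Finset (Finset α)) (huniform : ∀ A ∈ F, A.card = n)
    (hL : ∀ A ∈ F, ∀ B ∈ F, A ≠ B → ∃ i : Fin (s + 1), (A ∩ B).card = ℓ i)
    (m : ℕ) (hm : m = max (r - 1) (n ^ 2 - n + 1))
    (hcard : F.card * ((ℓ 0 + 1).factorial *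
        (∏ i : Fin s, (ℓ i.succ - ℓ i.castSucc).factorial) *
        (n - ℓ (Fin.last s) - 1).factorial) > n.factorial * m ^ (s + 1)) :
    HasSunflower F r := by
  by_contra hS
  have hsq : n ^ 2 - n = n * (n - 1) := by
    rw [sq, Nat.mul_sub, mul_one]
  have := sunflower_aux r m (by omega) s n ℓ hmono hlast (by omega) F huniform hL hS
  omega
end

section
/- Let F be a d-intersecting, n-uniform set family. There exists an absolute constant C such that for every r, n ≥ 3, if |F| > (4r)^n · [C r log(rd)]^d, then F contains an r-sunflower. -/
section Helpers

open Finset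

variable {X ι Q : Type} [Fintype X] [DecidableEq X] [Fintype ι] [DecidableEq ι]
  [Fintype Q] [DecidableEq Q]

/-- the points whose colour lies in `S` -/
def colU (S : Finset Q) (c : X → Q) : Finset X := univ.filter (fun x => c x ∈ S)

/-- number of members containing `T` -/
def degT (A : ι → Finset X) (T : Finset X) : ℕ := (univ.filter (fun i => T ⊆ A i)).card

/-- indices surviving the first `k` stages -/
def aliveJ (A : ι → Finset X) (S : ℕ → Finset Q) (L : ℕ → ℕ) (k : ℕ) (c : X → Q) (j : ι) : Prop :=
  ∀ m ≤ k, (A j \ colU (S m) c).card < L m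

def goodI (A : ι → Finset X) (S : ℕ → Finset Q) (L : ℕ → ℕ) (k : ℕ) (c : X → Q) (i : ι) : Prop :=
  ∃ j, aliveJ A S L k c j ∧ A j ⊆ colU (S k) c ∪ A i

lemma exists_fragment (A : ι → Finset X) (S : ℕ → Finset Q) (hS : Monotone S) (L : ℕ → ℕ) (k : ℕ)
    (ρ : Q → Q) (hρ : ∀ q, ρ q ∈ S (k+1) ∧ ρ q ∉ S k)
    (B : (X → Q) → Finset X)
    (hB : ∀ c, (∃ j, aliveJ A S L k c j ∧ A j ⊆ colU (S (k+1)) c) →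
      ∃ j, aliveJ A S L k c j ∧ A j ⊆ colU (S (k+1)) c ∧ B c = A j \ colU (S k) c)
    (c : X → Q) (i : ι) (h1 : goodI A S L k c i) (h2 : ¬ goodI A S L (k+1) c i) :
    ∃ T : Finset X, T ⊆ A i ∧ (∀ x ∈ T, c x ∉ S (k+1)) ∧ L (k+1) ≤ T.card ∧
      T ⊆ B (fun x => if x ∈ T then ρ (c x) else c x) := by
  classical
  obtain ⟨j0, hj0, hj0'⟩ := h1
  have hmono : ∀ x, c x ∈ S k → c x ∈ S (k+1) := fun x hx => hS (Nat.le_succ k) hx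
  have hne : (univ.filter (fun j => aliveJ A S L k c j ∧ A j ⊆ colU (S (k+1)) c ∪ A i)).Nonempty := by
    refine ⟨j0, ?_⟩
    simp only [mem_filter, mem_univ, true_and]
    refine ⟨hj0, fun x hx => ?_⟩
    have := hj0' hx
    simp only [mem_union, colU, mem_filter, mem_univ, true_and] at this ⊢
    exact this.imp (hmono x) id
  obtain ⟨j, hj, hmin⟩ := exists_min_image _ (fun j => (A j \ colU (S (k+1)) c).card) hne
  simp only [mem_filter, mem_univ, true_and] at hj hmin
  set T := A j \ colU (S (k+1)) c with hT
  have hTc : ∀ x ∈ T, c x ∉ S (k+1) := by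
    intro x hx
    simp [hT, colU] at hx
    exact hx.2
  have hTA : T ⊆ A i := by
    intro x hx
    have h3 := hj.2 (mem_sdiff.1 hx).1
    rcases mem_union.1 h3 with h | h
    · exact absurd h (mem_sdiff.1 hx).2
    · exact h
  refine ⟨T, hTA, hTc, ?_, ?_⟩
  · by_contra hlt
    push Not at hlt
    apply h2
    refine ⟨j, ?_, hj.2⟩
    intro m hm
    rcases Nat.le_succ_iff.1 hm with h | h
    · exact hj.1 m h
    · subst h; exact hlt
  · set c' : X → Q := fun x => if x ∈ T then ρ (c x) else c x with hc'
    have hUm : ∀ m ≤ k, colU (S m) c' = colU (S m) c := by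
      intro m hm
      ext x
      simp only [colU, mem_filter, mem_univ, true_and, hc']
      by_cases hx : x ∈ T
      · simp only [hx, if_true]
        constructor
        · intro h; exact absurd (hS hm h) (hρ (c x)).2
        · intro h; exact absurd (hS (Nat.le_succ_of_le hm) h) (hTc x hx)
      · simp [hx]
    have hU1 : colU (S (k+1)) c' = colU (S (k+1)) c ∪ T := by
      ext x
      simp only [colU, mem_filter, mem_univ, true_and, hc', mem_union]
      by_cases hx : x ∈ T
      · simp [hx, (hρ (c x)).1]
      · simp [hx]
    have hal : ∀ j, aliveJ A S L k c' j ↔ aliveJ A S L k c j := by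
      intro j
      unfold aliveJ
      refine forall₂_congr fun m hm => ?_
      rw [hUm m hm]
    obtain ⟨j', h1', h2', h3'⟩ := hB c' ⟨j, (hal j).2 hj.1, by
      rw [hU1, hT]; intro x hx
      by_cases h : x ∈ colU (S (k+1)) c <;> simp [h, hx]⟩
    rw [h3', hUm k le_rfl]
    rw [hU1] at h2'
    have h4 := hmin j' ⟨(hal j').1 h1', h2'.trans (union_subset_union_right hTA)⟩
    have h5 : A j' \ colU (S (k+1)) c ⊆ T := by
      intro x hx
      rcases mem_union.1 (h2' (mem_sdiff.1 hx).1) with h | h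
      · exact absurd h (mem_sdiff.1 hx).2
      · exact h
    have h6 := eq_of_subset_of_card_le h5 h4
    intro x hx
    have hx' := hx
    rw [← h6] at hx'
    refine mem_sdiff.2 ⟨(mem_sdiff.1 hx').1, ?_⟩
    intro h
    simp only [colU, mem_filter, mem_univ, true_and] at h
    exact hTc x hx (hmono x h)

open Classical in
lemma step_bound (A : ι → Finset X) (S : ℕ → Finset Q) (hS : Monotone S) (L : ℕ → ℕ) (k : ℕ)
    (hL : 0 < L k)
    (ρ : Q → Q) (hρ : ∀ q, ρ q ∈ S (k+1) ∧ ρ q ∉ S k) (b : ℕ)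
    (hb : ∀ q', (univ.filter (fun q => q ∉ S (k+1) ∧ ρ q = q')).card ≤ b)
    (E : ℝ)
    (hE : ∀ B : Finset X, B.card < L k →
      ∑ T ∈ B.powerset.filter (fun T => L (k+1) ≤ T.card), ((degT A T : ℝ) * (b:ℝ) ^ T.card) ≤ E) :
    ((univ.filter (fun p : ι × (X → Q) =>
      goodI A S L k p.2 p.1 ∧ ¬ goodI A S L (k+1) p.2 p.1)).card : ℝ)
      ≤ E * Fintype.card (X → Q) := by
  have hBex : ∀ c : X → Q, ∃ B : Finset X, B.card < L k ∧
      ((∃ j, aliveJ A S L k c j ∧ A j ⊆ colU (S (k+1)) c) →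
      ∃ j, aliveJ A S L k c j ∧ A j ⊆ colU (S (k+1)) c ∧ B = A j \ colU (S k) c) := by
    intro c
    by_cases h : ∃ j, aliveJ A S L k c j ∧ A j ⊆ colU (S (k+1)) c
    · obtain ⟨j, hj, hj'⟩ := h
      exact ⟨A j \ colU (S k) c, hj k le_rfl, fun _ => ⟨j, hj, hj', rfl⟩⟩
    · exact ⟨∅, by simpa using hL, fun h' => absurd h' h⟩
  choose B hBc hB using hBex
  let pf : Finset X → (X → Q) → Finset (X → Q) := fun T c' =>
    Fintype.piFinset (fun x => if x ∈ T then univ.filter (fun q => q ∉ S (k+1) ∧ ρ q = c' x)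
      else {c' x})
  have hpf : ∀ T c', (pf T c').card ≤ b ^ T.card := by
    intro T c'
    simp only [pf, Fintype.card_piFinset]
    calc _ ≤ ∏ x : X, (if x ∈ T then b else 1) := by
          refine prod_le_prod' fun x _ => ?_
          by_cases hx : x ∈ T
          · simp only [hx, if_true]; exact hb _
          · simp [hx]
      _ = b ^ T.card := by
          rw [prod_ite]
          simp
  have hsub : (univ.filter (fun p : ι × (X → Q) =>
      goodI A S L k p.2 p.1 ∧ ¬ goodI A S L (k+1) p.2 p.1)) ⊆
      (univ : Finset (X → Q)).biUnion (fun c' =>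
        ((B c').powerset.filter (fun T => L (k+1) ≤ T.card)).biUnion (fun T =>
          (univ.filter (fun i => T ⊆ A i)) ×ˢ pf T c')) := by
    rintro ⟨i, c⟩ hp
    simp only [mem_filter, mem_univ, true_and] at hp
    obtain ⟨T, h1, h2, h3, h4⟩ := exists_fragment A S hS L k ρ hρ B hB c i hp.1 hp.2
    simp only [mem_biUnion, mem_univ, true_and, mem_filter, mem_powerset, mem_product]
    refine ⟨_, T, ⟨h4, h3⟩, h1, ?_⟩
    simp only [pf, Fintype.mem_piFinset]
    intro x
    by_cases hx : x ∈ T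
    · simp [hx, h2 x hx]
    · simp [hx]
  have hnat := (card_le_card hsub).trans card_biUnion_le
  calc _ ≤ ((∑ c' : X → Q, (((B c').powerset.filter (fun T => L (k+1) ≤ T.card)).biUnion (fun T =>
          (univ.filter (fun i => T ⊆ A i)) ×ˢ pf T c')).card : ℕ) : ℝ) := by exact_mod_cast hnat
    _ ≤ ∑ c' : X → Q, E := by
        push_cast
        refine sum_le_sum fun c' _ => le_trans ?_ (hE (B c') (hBc c'))
        calc _ ≤ ((∑ T ∈ (B c').powerset.filter (fun T => L (k+1) ≤ T.card),
              ((univ.filter (fun i => T ⊆ A i)) ×ˢ pf T c').card : ℕ) : ℝ) := by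
              exact_mod_cast card_biUnion_le
          _ ≤ _ := by
              push_cast
              refine sum_le_sum fun T _ => ?_
              rw [card_product]
              push_cast
              refine mul_le_mul (le_of_eq ?_) (by exact_mod_cast hpf T c') (by positivity) (by positivity)
              simp [degT]
    _ = _ := by simp [mul_comm]

open Classical in
lemma telescoped (A : ι → Finset X) (S : ℕ → Finset Q) (L : ℕ → ℕ) (E : ℕ → ℝ) (K : ℕ)
    (h0 : ∀ c i, goodI A S L 0 c i)
    (h : ∀ k < K, ((univ.filter (fun p : ι × (X → Q) =>
      goodI A S L k p.2 p.1 ∧ ¬ goodI A S L (k+1) p.2 p.1)).card : ℝ)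
      ≤ E k * Fintype.card (X → Q)) :
    ∀ k ≤ K, ((univ.filter (fun p : ι × (X → Q) => ¬ goodI A S L k p.2 p.1)).card : ℝ)
      ≤ (∑ m ∈ range k, E m) * Fintype.card (X → Q) := by
  intro k
  induction k with
  | zero => intro _; simp [h0]
  | succ k ih =>
    intro hk
    have h1 := ih (by omega)
    have h2 := h k (by omega)
    have h3 : (univ.filter (fun p : ι × (X → Q) => ¬ goodI A S L (k+1) p.2 p.1)) ⊆
       (univ.filter (fun p : ι × (X → Q) => ¬ goodI A S L k p.2 p.1)) ∪
       (univ.filter (fun p : ι × (X → Q) =>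
      goodI A S L k p.2 p.1 ∧ ¬ goodI A S L (k+1) p.2 p.1)) := by
      intro p hp
      simp only [mem_filter, mem_univ, true_and, mem_union] at hp ⊢
      tauto
    have h4 : ((univ.filter (fun p : ι × (X → Q) => ¬ goodI A S L (k+1) p.2 p.1)).card : ℝ) ≤
       (univ.filter (fun p : ι × (X → Q) => ¬ goodI A S L k p.2 p.1)).card +
       (univ.filter (fun p : ι × (X → Q) =>
      goodI A S L k p.2 p.1 ∧ ¬ goodI A S L (k+1) p.2 p.1)).card := by
      exact_mod_cast (card_le_card h3).trans (card_union_le _ _)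
    rw [sum_range_succ, add_mul]
    linarith

/-- colours of class `j` used up to stage `k` -/
def colS (r s : ℕ) (j : Fin (2*r)) (k : ℕ) : Finset (Fin (2*r) × Bool × Fin s) :=
  univ.filter (fun q => q.1 = j ∧
    ((q.2.1 = false ∧ 0 < k) ∨ (q.2.1 = true ∧ q.2.2.val + 1 < k)))

/-- size thresholds -/
def sizeL (n d s : ℕ) : ℕ → ℕ
  | 0 => n + 1
  | k+1 => min (2^(s-k)) (d+1)

lemma geom_small (s : ℕ) :
    ∑ k ∈ range s, (1/16 : ℝ)^(s-k) = (1 - (1/16 : ℝ)^s) / 15 := by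
  induction s with
  | zero => simp
  | succ s ih =>
    rw [sum_range_succ']
    simp only [Nat.add_sub_add_right, Nat.sub_zero]
    rw [ih, pow_succ]
    ring

lemma first_step_sum (A : ι → Finset X) (r n d : ℕ) (hr : 1 ≤ r)
    (h1 : ∀ T : Finset X, d + 1 ≤ T.card → degT A T ≤ 1) (B : Finset X) (hB : B.card < n + 1) :
    ∑ T ∈ B.powerset.filter (fun T => d + 1 ≤ T.card),
      ((degT A T : ℝ) * ((4*r-1 : ℕ):ℝ) ^ T.card) ≤ (4*r:ℝ)^n := by
  have hcast : ((4*r-1 : ℕ):ℝ) = 4*r - 1 := by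
    rw [Nat.cast_sub (by omega)]; push_cast; ring
  have hr' : (1:ℝ) ≤ r := by exact_mod_cast hr
  calc _ ≤ ∑ T ∈ B.powerset.filter (fun T => d + 1 ≤ T.card), ((4*r-1 : ℕ):ℝ) ^ T.card := by
        refine sum_le_sum fun T hT => ?_
        have : (degT A T : ℝ) ≤ 1 := by exact_mod_cast h1 T (mem_filter.1 hT).2
        exact mul_le_of_le_one_left (by positivity) this
    _ ≤ ∑ T ∈ B.powerset, ((4*r-1 : ℕ):ℝ) ^ T.card :=
        sum_le_sum_of_subset_of_nonneg (filter_subset _ _) (fun _ _ _ => by positivity)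
    _ = (4*r:ℝ)^B.card := by
        have := Finset.sum_pow_mul_eq_add_pow ((4*r-1 : ℕ):ℝ) 1 B
        simp only [one_pow, mul_one] at this
        rw [this, hcast]; congr 1; ring
    _ ≤ _ := pow_le_pow_right₀ (by linarith) (by omega)

lemma later_step_sum (A : ι → Finset X) (r s d h : ℕ) (hr : 1 ≤ r) (hs : 1 ≤ s)
    (h2 : ∀ T : Finset X, T.card ≤ d →
      (degT A T : ℝ) * (256 * r * s : ℝ) ^ T.card ≤ Fintype.card ι)
    (B : Finset X) (hB : B.card < min (2 * h) (d+1)) :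
    ∑ T ∈ B.powerset.filter (fun T => min h (d+1) ≤ T.card),
      ((degT A T : ℝ) * ((4*r*s : ℕ):ℝ) ^ T.card) ≤ Fintype.card ι * (1/16:ℝ)^h := by
  have hB1 : B.card ≤ 2 * h := by omega
  have hB2 : B.card ≤ d := by omega
  have hterm : ∀ T ∈ B.powerset.filter (fun T => min h (d+1) ≤ T.card),
      ((degT A T : ℝ) * ((4*r*s : ℕ):ℝ) ^ T.card) ≤ Fintype.card ι * (1/64:ℝ)^h := by
    intro T hT
    simp only [mem_filter, mem_powerset] at hT
    have hTd : T.card ≤ d := (card_le_card hT.1).trans hB2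
    have hTh : h ≤ T.card := by omega
    have e : (256 * r * s : ℝ) = ((4*r*s : ℕ):ℝ) * 64 := by push_cast; ring
    have := h2 T hTd
    rw [e, mul_pow, ← mul_assoc] at this
    have h3 : (degT A T : ℝ) * ((4*r*s : ℕ):ℝ) ^ T.card ≤ Fintype.card ι * (1/64:ℝ)^T.card := by
      rw [div_pow, one_pow, mul_one_div, le_div_iff₀ (by positivity)]
      exact this
    refine h3.trans (mul_le_mul_of_nonneg_left ?_ (by positivity))
    exact pow_le_pow_of_le_one (by norm_num) (by norm_num) hTh
  refine (sum_le_card_nsmul _ _ _ hterm).trans ?_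
  rw [nsmul_eq_mul]
  have hc : ((B.powerset.filter (fun T => min h (d+1) ≤ T.card)).card : ℝ) ≤ 4^h := by
    have : (B.powerset.filter (fun T => min h (d+1) ≤ T.card)).card ≤ 4^h := by
      refine (card_filter_le _ _).trans ?_
      rw [card_powerset]
      calc 2^B.card ≤ 2^(2*h) := Nat.pow_le_pow_right (by norm_num) hB1
        _ = 4^h := by rw [pow_mul]; norm_num
    exact_mod_cast this
  calc _ ≤ (4:ℝ)^h * (Fintype.card ι * (1/64:ℝ)^h) :=
        mul_le_mul_of_nonneg_right hc (by positivity)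
    _ = Fintype.card ι * (4 * (1/64:ℝ))^h := by rw [mul_pow]; ring
    _ = _ := by norm_num

open Classical in
lemma class_fail (A : ι → Finset X) (r s n d : ℕ) (hr : 1 ≤ r) (hs : 1 ≤ s) (hd : d < 2^s)
    (hn : ∀ i, (A i).card ≤ n)
    (h1 : ∀ T : Finset X, d + 1 ≤ T.card → degT A T ≤ 1)
    (h2 : ∀ T : Finset X, T.card ≤ d →
      (degT A T : ℝ) * (256 * r * s : ℝ) ^ T.card ≤ Fintype.card ι)
    (h3 : (4*r:ℝ)^n * 3 ≤ Fintype.card ι) (j : Fin (2*r)) :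
    2 * ((univ.filter (fun c : X → Fin (2*r) × Bool × Fin s =>
      ∀ i, ¬ A i ⊆ colU (univ.filter (fun q => q.1 = j)) c)).card : ℝ)
      < Fintype.card (X → Fin (2*r) × Bool × Fin s) := by
  have hr' : (1:ℝ) ≤ r := by exact_mod_cast hr
  set M : ℝ := ((Fintype.card ι : ℕ) : ℝ) with hM
  have hMpos : 0 < M := lt_of_lt_of_le (by positivity) h3
  have hSm : Monotone (colS r s j) := by
    intro a b hab q hq
    simp only [colS, mem_filter, mem_univ, true_and] at hq ⊢
    refine ⟨hq.1, hq.2.imp (fun h => ⟨h.1, by omega⟩) (fun h => ⟨h.1, by omega⟩)⟩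
  let E : ℕ → ℝ := fun k => Nat.casesOn k ((4*r:ℝ)^n) (fun k => M * (1/16:ℝ)^(s-k))
  have hcardQ : Fintype.card (Fin (2*r) × Bool × Fin s) = 4*r*s := by
    simp; ring
  have hstep : ∀ k < s + 1, ((univ.filter (fun p : ι × (X → Fin (2*r) × Bool × Fin s) =>
      goodI A (colS r s j) (sizeL n d s) k p.2 p.1 ∧
      ¬ goodI A (colS r s j) (sizeL n d s) (k+1) p.2 p.1)).card : ℝ)
      ≤ E k * Fintype.card (X → Fin (2*r) × Bool × Fin s) := by
    intro k hk
    cases k with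
    | zero =>
      refine step_bound A _ hSm _ 0 (by simp [sizeL]) (fun q => (j, false, q.2.2)) ?_ (4*r-1) ?_ _ ?_
      · intro q; simp [colS]
      · rintro ⟨a, b, m⟩
        have : (((univ : Finset (Fin (2*r) × Bool)).erase (j, false))).card = 4*r-1 := by
          rw [card_erase_of_mem (mem_univ _)]
          simp; omega
        rw [← this]
        refine card_le_card_of_injOn (fun q => (q.1, q.2.1)) ?_ ?_
        · rintro ⟨a', b', m'⟩ hq
          simp [colS] at hq ⊢
          exact hq.1
        · rintro ⟨a1, b1, m1⟩ hq1 ⟨a2, b2, m2⟩ hq2 heq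
          simp at hq1 hq2 heq ⊢
          refine ⟨heq.1, heq.2, ?_⟩
          rw [hq1.2.2.2, hq2.2.2.2]
      · intro B hB
        have e : sizeL n d s (0+1) = d + 1 := by simp [sizeL]; omega
        rw [e]
        exact first_step_sum A r n d hr h1 B hB
    | succ k =>
      have hks : k < s := by omega
      have hp : 2^(s-k) = 2 * 2^(s-(k+1)) := by
        rw [← pow_succ']; congr 1; omega
      refine step_bound A _ hSm _ (k+1) (by simp [sizeL]) (fun q => (j, true, ⟨k, hks⟩)) ?_ (4*r*s) ?_ _ ?_
      · intro q; simp [colS]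
      · intro q'
        rw [← hcardQ]
        exact card_le_univ _
      · intro B hB
        simp only [sizeL] at hB ⊢
        rw [hp] at hB
        refine (later_step_sum A r s d _ hr hs h2 B hB).trans ?_
        refine mul_le_mul_of_nonneg_left ?_ hMpos.le
        refine pow_le_pow_of_le_one (by norm_num) (by norm_num) ?_
        have := Nat.lt_two_pow_self (n := s-(k+1))
        omega
  have h0 : ∀ c i, goodI A (colS r s j) (sizeL n d s) 0 c i := by
    intro c i
    refine ⟨i, ?_, subset_union_right⟩
    intro m hm
    obtain rfl : m = 0 := by omega
    have := card_le_card (sdiff_subset (s := A i) (t := colU (colS r s j 0) c))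
    have := hn i
    simp only [sizeL]; omega
  have htel := telescoped A (colS r s j) (sizeL n d s) E (s+1) h0 hstep (s+1) le_rfl
  have hsum : ∑ m ∈ range (s+1), E m < M / 2 := by
    rw [sum_range_succ']
    change ∑ k ∈ range s, M * (1/16:ℝ)^(s-k) + (4*r:ℝ)^n < M/2
    rw [← mul_sum, geom_small]
    have : (0:ℝ) < (1/16)^s := by positivity
    nlinarith
  have hpos : (0:ℝ) < Fintype.card (X → Fin (2*r) × Bool × Fin s) := by
    have : Nonempty (X → Fin (2*r) × Bool × Fin s) := ⟨fun _ => (j, false, ⟨0, by omega⟩)⟩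
    exact_mod_cast Fintype.card_pos
  have hprod : (univ : Finset ι) ×ˢ (univ.filter (fun c : X → Fin (2*r) × Bool × Fin s =>
      ∀ i, ¬ A i ⊆ colU (univ.filter (fun q => q.1 = j)) c)) ⊆
      (univ.filter (fun p : ι × (X → Fin (2*r) × Bool × Fin s) =>
        ¬ goodI A (colS r s j) (sizeL n d s) (s+1) p.2 p.1)) := by
    rintro ⟨i, c⟩ hp
    simp only [mem_product, mem_filter, mem_univ, true_and] at hp ⊢
    rintro ⟨i', hi', -⟩
    apply hp i'
    have := hi' (s+1) le_rfl
    have hz : (A i' \ colU (colS r s j (s+1)) c).card = 0 := by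
      simp [sizeL] at this
      simp [this]
    rw [card_eq_zero, sdiff_eq_empty_iff_subset] at hz
    refine hz.trans ?_
    intro x hx
    simp only [colU, colS, mem_filter, mem_univ, true_and] at hx ⊢
    exact hx.1
  have hle := card_le_card hprod
  rw [card_product, card_univ] at hle
  have hle' : M * ((univ.filter (fun c : X → Fin (2*r) × Bool × Fin s =>
      ∀ i, ¬ A i ⊆ colU (univ.filter (fun q => q.1 = j)) c)).card : ℝ) ≤
      (∑ m ∈ range (s+1), E m) * Fintype.card (X → Fin (2*r) × Bool × Fin s) := by
    refine le_trans ?_ htel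
    rw [hM]; exact_mod_cast hle
  have hlt := mul_lt_mul_of_pos_right hsum hpos
  have := hle'.trans_lt hlt
  have h5 : M * (2 * ((univ.filter (fun c : X → Fin (2*r) × Bool × Fin s =>
      ∀ i, ¬ A i ⊆ colU (univ.filter (fun q => q.1 = j)) c)).card : ℝ)) <
      M * Fintype.card (X → Fin (2*r) × Bool × Fin s) := by linarith
  exact lt_of_mul_lt_mul_left h5 hMpos.le

lemma spread_disjoint (A : ι → Finset X) (r s n d : ℕ) (hr : 1 ≤ r) (hs : 1 ≤ s) (hd : d < 2^s)
    (hne : ∀ i, (A i).Nonempty)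
    (hn : ∀ i, (A i).card ≤ n)
    (h1 : ∀ T : Finset X, d + 1 ≤ T.card → degT A T ≤ 1)
    (h2 : ∀ T : Finset X, T.card ≤ d →
      (degT A T : ℝ) * (256 * r * s : ℝ) ^ T.card ≤ Fintype.card ι)
    (h3 : (4*r:ℝ)^n * 3 ≤ Fintype.card ι) :
    ∃ P : Finset ι, P.card = r ∧ ∀ a ∈ P, ∀ b ∈ P, a ≠ b → Disjoint (A a) (A b) := by
  classical
  let fails : Fin (2*r) → (X → Fin (2*r) × Bool × Fin s) → Prop := fun j c =>
    ∀ i, ¬ A i ⊆ colU (univ.filter (fun q => q.1 = j)) c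
  have hex : ∃ c : X → Fin (2*r) × Bool × Fin s, (univ.filter (fun j => fails j c)).card < r := by
    by_contra hcon
    push Not at hcon
    have hdc : ∑ j, (univ.filter (fun c => fails j c)).card =
        ∑ c, (univ.filter (fun j => fails j c)).card := by
      simp only [card_filter]
      rw [sum_comm]
    have hlow : Fintype.card (X → Fin (2*r) × Bool × Fin s) * r ≤
        ∑ c, (univ.filter (fun j => fails j c)).card := by
      have := card_nsmul_le_sum univ (fun c => (univ.filter (fun j => fails j c)).card) r
        (fun c _ => hcon c)
      simpa using this
    have hup : ∑ j, 2 * ((univ.filter (fun c => fails j c)).card : ℝ) <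
        ∑ j : Fin (2*r), (Fintype.card (X → Fin (2*r) × Bool × Fin s) : ℝ) := by
      refine sum_lt_sum_of_nonempty ⟨⟨0, by omega⟩, mem_univ _⟩ fun j _ => ?_
      exact class_fail A r s n d hr hs hd hn h1 h2 h3 j
    rw [← mul_sum] at hup
    rw [← hdc] at hlow
    have hlow' : (Fintype.card (X → Fin (2*r) × Bool × Fin s) * r : ℝ) ≤
        ∑ j, ((univ.filter (fun c => fails j c)).card : ℝ) := by exact_mod_cast hlow
    rw [sum_const, card_univ, Fintype.card_fin, nsmul_eq_mul] at hup
    push_cast at hup hlow'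
    nlinarith
  obtain ⟨c, hc⟩ := hex
  have hgood : r ≤ (univ.filter (fun j => ¬ fails j c)).card := by
    have := card_filter_add_card_filter_not (s := (univ : Finset (Fin (2*r)))) (fun j => fails j c)
    rw [card_univ, Fintype.card_fin] at this
    omega
  obtain ⟨G, hG, hGc⟩ := exists_subset_card_eq hgood
  have hch : ∀ j : Fin (2*r), ∃ i, j ∈ G → A i ⊆ colU (univ.filter (fun q => q.1 = j)) c := by
    intro j
    by_cases hj : j ∈ G
    · have := (mem_filter.1 (hG hj)).2
      simp only [fails, not_forall, not_not] at this
      obtain ⟨i, hi⟩ := this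
      exact ⟨i, fun _ => hi⟩
    · have : Nonempty ι := by
        have hp : (0:ℝ) < Fintype.card ι := lt_of_lt_of_le (by positivity) h3
        exact Fintype.card_pos_iff.1 (by exact_mod_cast hp)
      exact ⟨Classical.arbitrary ι, fun h => absurd h hj⟩
  choose f hf using hch
  have hdis : ∀ a ∈ G, ∀ b ∈ G, a ≠ b → Disjoint (A (f a)) (A (f b)) := by
    intro a ha b hb hab
    rw [disjoint_left]
    intro x hxa hxb
    have h1 := hf a ha hxa
    have h2 := hf b hb hxb
    simp [colU] at h1 h2
    exact hab (h1.symm.trans h2)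
  have hinj : Set.InjOn f G := by
    intro a ha b hb hab
    by_contra hne'
    have := hdis a ha b hb hne'
    rw [hab, disjoint_self] at this
    exact (hne (f b)).ne_empty this
  refine ⟨G.image f, by rw [card_image_of_injOn hinj, hGc], ?_⟩
  intro a ha b hb hab
  obtain ⟨a', ha', rfl⟩ := mem_image.1 ha
  obtain ⟨b', hb', rfl⟩ := mem_image.1 hb
  exact hdis a' ha' b' hb' (fun h => hab (by rw [h]))

end Helpers

section Final

open Finset

lemma log_bound (r d : ℕ) (hr : 3 ≤ r) (hd : 1 ≤ d) :
    (256 * r * (Nat.log 2 d + 1 : ℕ) : ℝ) ≤ 1024 * r * Real.log (r * d) := by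
  have hr' : (3:ℝ) ≤ r := by exact_mod_cast hr
  have hd' : (1:ℝ) ≤ d := by exact_mod_cast hd
  have h1 : (1:ℝ) ≤ Real.log r := by
    rw [Real.le_log_iff_exp_le (by linarith)]
    have := Real.exp_one_lt_d9
    linarith
  have h0 : 0 ≤ Real.log d := Real.log_nonneg hd'
  have h2 : (Nat.log 2 d : ℝ) * Real.log 2 ≤ Real.log d := by
    rw [← Real.log_pow]
    apply Real.log_le_log (by positivity)
    exact_mod_cast Nat.pow_log_le_self 2 (by omega)
  have h3 := Real.log_two_gt_d9
  have h4 : (0:ℝ) ≤ Nat.log 2 d := by positivity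
  rw [Real.log_mul (by positivity) (by positivity)]
  have h5 : ((Nat.log 2 d + 1 : ℕ) : ℝ) ≤ 4 * (Real.log r + Real.log d) := by
    push_cast
    nlinarith
  nlinarith

lemma sunflower_aux_s12 (α : Type) [DecidableEq α] (r n d : ℕ) (hr : 3 ≤ r) (hn : 3 ≤ n)
    (F : Finset (Finset α)) (hF : ∀ A ∈ F, A.card = n)
    (hI : ∀ A ∈ F, ∀ B ∈ F, A ≠ B → (A ∩ B).card ≤ d) (K : ℝ)
    (hK : 1 ≤ d → (256 * r * (Nat.log 2 d + 1 : ℕ) : ℝ) ≤ K)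
    (hc : (4 * r : ℝ) ^ n * K ^ d < F.card) : HasSunflower F r := by
  classical
  have hr' : (3:ℝ) ≤ r := by exact_mod_cast hr
  set Y : Finset α := F.biUnion id with hY
  set cand := Y.powerset.filter (fun S => S.card ≤ d ∧
    (4 * r : ℝ) ^ n * K ^ (d - S.card) < ((F.filter (fun A => S ⊆ A)).card : ℝ)) with hcand
  have hne : cand.Nonempty := ⟨∅, by simpa [hcand] using hc⟩
  obtain ⟨S, hS, hmax⟩ := exists_max_image cand card hne
  simp only [hcand, mem_filter, mem_powerset] at hS hmax
  obtain ⟨hSY, hSd, hSc⟩ := hS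
  set FS := F.filter (fun A => S ⊆ A) with hFS
  have hpowr : (r:ℝ) ≤ (4 * r : ℝ) ^ n := by
    calc (r:ℝ) ≤ (4*r)^1 := by linarith
      _ ≤ _ := pow_le_pow_right₀ (by linarith) (by omega)
  rcases Nat.eq_zero_or_pos (d - S.card) with hd0 | hdpos
  · -- pairwise disjoint outside the core
    rw [hd0, pow_zero, mul_one] at hSc
    have : r ≤ FS.card := by
      have : (r:ℝ) ≤ FS.card := by linarith
      exact_mod_cast this
    obtain ⟨P, hP, hPc⟩ := exists_subset_card_eq this
    refine ⟨P, hP.trans (filter_subset _ _), hPc, S, ?_⟩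
    intro A hA B hB hAB
    have hA' := mem_filter.1 (hP hA)
    have hB' := mem_filter.1 (hP hB)
    symm
    apply eq_of_subset_of_card_le (subset_inter hA'.2 hB'.2)
    have := hI A hA'.1 B hB'.1 hAB
    omega
  · have hd1 : 1 ≤ d := by omega
    have hK' := hK hd1
    set s := Nat.log 2 d + 1 with hs
    have hsr : (1:ℝ) ≤ (s:ℝ) := by exact_mod_cast (by omega : 1 ≤ s)
    have hKK : (3:ℝ) ≤ 256 * r * s := by nlinarith
    have hK3 : 3 ≤ K := hKK.trans hK'
    have hM3 : (4*r:ℝ)^n * 3 ≤ FS.card := by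
      refine le_trans ?_ hSc.le
      refine mul_le_mul_of_nonneg_left ?_ (by positivity)
      calc (3:ℝ) ≤ K^1 := by simpa using hK3
        _ ≤ _ := pow_le_pow_right₀ (by linarith) hdpos
    let A : FS → Finset Y := fun i => (i.1 \ S).subtype (· ∈ Y)
    have hmemY : ∀ B ∈ F, ∀ x ∈ B, x ∈ Y := by
      intro B hB x hx
      exact mem_biUnion.2 ⟨B, hB, hx⟩
    have hmemA : ∀ (i : FS) (x : Y), x ∈ A i ↔ x.1 ∈ i.1 ∧ x.1 ∉ S := by
      intro i x; simp [A]
    have hiF : ∀ i : FS, i.1 ∈ F ∧ S ⊆ i.1 := fun i => mem_filter.1 i.2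
    have hkey : ∀ (T : Finset Y) (i : FS), T ⊆ A i →
        S ∪ T.map (Function.Embedding.subtype _) ⊆ i.1 ∧
        (S ∪ T.map (Function.Embedding.subtype _)).card = S.card + T.card := by
      intro T i hT
      constructor
      · refine union_subset (hiF i).2 ?_
        intro x hx
        obtain ⟨y, hy, rfl⟩ := mem_map.1 hx
        exact ((hmemA i y).1 (hT hy)).1
      · rw [card_union_of_disjoint, card_map]
        rw [disjoint_right]
        intro x hx
        obtain ⟨y, hy, rfl⟩ := mem_map.1 hx
        exact ((hmemA i y).1 (hT hy)).2
    obtain ⟨P, hPc, hP⟩ := spread_disjoint A r s n (d - S.card) (by omega) (by omega)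
      (lt_of_le_of_lt (Nat.sub_le _ _) (Nat.lt_pow_succ_log_self (by norm_num) d))
      (by
        intro i
        by_contra hemp
        have hle1 : FS.card ≤ 1 := by
          have hiS : i.1 ⊆ S := by
            intro x hx
            by_contra hxS
            exact hemp ⟨⟨x, hmemY _ (hiF i).1 x hx⟩, (hmemA i _).2 ⟨hx, hxS⟩⟩
          have hSn : S.card = n := by
            have := card_le_card hiS
            have h2 := card_le_card (hiF i).2
            have h3 := hF _ (hiF i).1
            omega
          have hall : ∀ B ∈ FS, B = S := by
            intro B hB
            have hB' := mem_filter.1 hB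
            exact (eq_of_subset_of_card_le hB'.2 (by rw [hF B hB'.1, hSn])).symm
          rw [card_le_one]
          intro a ha b hb
          rw [hall a ha, hall b hb]
        have : (FS.card : ℝ) ≤ 1 := by exact_mod_cast hle1
        linarith)
      (by
        intro i
        have h1 : (A i).card ≤ i.1.card := by
          have h2 := (hkey (A i) i subset_rfl)
          have h3 := card_le_card h2.1
          omega
        rw [hF _ (hiF i).1] at h1
        exact h1)
      (by
        intro T hT
        unfold degT
        rw [card_le_one]
        intro a ha b hb
        by_contra hab
        have ha' := hkey T a (mem_filter.1 ha).2
        have hb' := hkey T b (mem_filter.1 hb).2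
        have h1 := card_le_card (subset_inter ha'.1 hb'.1)
        have h2 := hI a.1 (hiF a).1 b.1 (hiF b).1 (fun h => hab (Subtype.ext h))
        omega)
      (by
        intro T hT
        rw [Fintype.card_coe]
        rcases Nat.eq_zero_or_pos (degT A T) with h0 | h0
        · rw [h0]; simp
        rcases Nat.eq_zero_or_pos T.card with hT0 | hT0
        · rw [hT0, pow_zero, mul_one]
          have : degT A T ≤ FS.card := by
            unfold degT
            refine (card_le_univ _).trans ?_
            simp
          exact_mod_cast this
        have h0' := h0
        unfold degT at h0'
        obtain ⟨i, hi⟩ := card_pos.1 h0'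
        have hi' := hkey T i (mem_filter.1 hi).2
        set S' := S ∪ T.map (Function.Embedding.subtype _) with hS'
        have hnot : ¬ ((4 * r : ℝ) ^ n * K ^ (d - S'.card) <
            ((F.filter (fun A => S' ⊆ A)).card : ℝ)) := by
          intro hlt
          have := hmax S' ⟨fun x hx => hmemY _ (hiF i).1 x (hi'.1 hx), by omega, hlt⟩
          omega
        push Not at hnot
        have hdeg : degT A T ≤ (F.filter (fun A => S' ⊆ A)).card := by
          unfold degT
          refine card_le_card_of_injOn (fun i => i.1) ?_ (fun a _ b _ h => Subtype.ext h)
          intro a ha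
          have ha' := hkey T a (mem_filter.1 ha).2
          exact mem_filter.2 ⟨(hiF a).1, ha'.1⟩
        have hdeg' : (degT A T : ℝ) ≤ (4 * r : ℝ) ^ n * K ^ (d - S'.card) :=
          le_trans (by exact_mod_cast hdeg) hnot
        calc (degT A T : ℝ) * (256 * r * s : ℝ) ^ T.card
            ≤ ((4 * r : ℝ) ^ n * K ^ (d - S'.card)) * K ^ T.card := by
              refine mul_le_mul hdeg' (pow_le_pow_left₀ (by positivity) hK' _) (by positivity)
                (by positivity)
          _ = (4 * r : ℝ) ^ n * K ^ (d - S.card) := by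
              rw [mul_assoc, ← pow_add]
              congr 2
              omega
          _ ≤ _ := hSc.le)
      (by rw [Fintype.card_coe]; exact hM3)
    refine ⟨P.map (Function.Embedding.subtype _), ?_, by rw [card_map, hPc], S, ?_⟩
    · intro B hB
      obtain ⟨b, hb, rfl⟩ := mem_map.1 hB
      exact (hiF b).1
    · intro B hB B' hB' hne'
      obtain ⟨b, hb, rfl⟩ := mem_map.1 hB
      obtain ⟨b', hb', rfl⟩ := mem_map.1 hB'
      have hdis := hP b hb b' hb' (fun h => hne' (by rw [h]))
      apply Subset.antisymm
      · intro x hx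
        by_contra hxS
        have hx' := mem_inter.1 hx
        have hxY := hmemY _ (hiF b).1 x hx'.1
        exact disjoint_left.1 hdis ((hmemA b ⟨x, hxY⟩).2 ⟨hx'.1, hxS⟩)
          ((hmemA b' ⟨x, hxY⟩).2 ⟨hx'.2, hxS⟩)
      · exact subset_inter (hiF b).2 (hiF b').2

end Final

/-- main theorem for d-intersecting families. -/
theorem d_intersecting_sunflower :
    ∃ C : ℝ, C > 0 ∧ ∀ (α : Type) [DecidableEq α], ∀ (r n d : ℕ),
      3 ≤ r → 3 ≤ n → ∀ F : Finset (Finset α),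
      (∀ A ∈ F, A.card = n) →
      (∀ A ∈ F, ∀ B ∈ F, A ≠ B → (A ∩ B).card ≤ d) →
      (F.card : ℝ) > (4 * r) ^ n * (C * r * Real.log (r * d)) ^ d →
      HasSunflower F r := by
  refine ⟨1024, by norm_num, ?_⟩
  intro α _ r n d hr hn F hF hI hc
  exact sunflower_aux_s12 α r n d hr hn F hF hI _ (log_bound r d hr) hc
end

section
/- For any C > 1 there exists c = c(r) > 0 such that if F is an n-uniform, r-sunflower-free family with |F| ≥ (C·4r)^n and 3 ≤ r ≤ log n, then there exist F_1, F_2 ∈ F with |F_1 ∩ F_2| ≥ c·n/log log n. -/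
theorem sf_recolor {β κ : Type*} [Fintype β] [DecidableEq β] [Fintype κ] [DecidableEq κ]
    (D : Finset κ) (Y : Finset β) :
    ∀ (a b : (β → κ) → ℝ), (∀ f, 0 ≤ b f) →
    (∀ f f' : β → κ, (∀ x, x ∉ Y → f' x = f x) → (∀ x ∈ Y, f' x ∈ D) → a f ≤ b f') →
    (D.card : ℝ) ^ Y.card * ∑ f, a f ≤ (Fintype.card κ : ℝ) ^ Y.card * ∑ f, b f := by
  induction Y using Finset.induction_on with
  | empty =>
    intro a b _ h
    simpa using Finset.sum_le_sum (fun f _ => h f f (by simp) (by simp))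
  | insert x Y hx ih =>
    intro a b hb h
    have h1 := ih (fun f => D.card * a f) (fun f => ∑ c ∈ D, b (Function.update f x c))
      (fun f => Finset.sum_nonneg (fun c _ => hb _)) (by
        intro f f' h1 h2
        have : ∀ c ∈ D, a f ≤ b (Function.update f' x c) := by
          intro c hc
          apply h
          · intro y hy
            simp only [Finset.mem_insert, not_or] at hy
            rw [Function.update_of_ne hy.1, h1 y hy.2]
          · intro y hy
            rcases eq_or_ne y x with rfl | hne
            · simpa using hc
            · rw [Function.update_of_ne hne]
              exact h2 y (Finset.mem_of_mem_insert_of_ne hy hne)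
        calc D.card * a f = ∑ c ∈ D, a f := by simp
          _ ≤ _ := Finset.sum_le_sum this)
    have h2 : ∑ f, ∑ c ∈ D, b (Function.update f x c) ≤ (Fintype.card κ : ℝ) * ∑ f, b f := by
      calc ∑ f, ∑ c ∈ D, b (Function.update f x c)
          ≤ ∑ f, ∑ c, b (Function.update f x c) :=
            Finset.sum_le_sum (fun f _ => Finset.sum_le_sum_of_subset_of_nonneg
              (Finset.subset_univ _) (fun c _ _ => hb _))
        _ = ∑ q : (β → κ) × κ, b (Function.update q.1 x q.2) := by
            rw [Fintype.sum_prod_type]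
        _ = ∑ q : (β → κ) × κ, b q.1 := by
            refine Finset.sum_bij' (fun q _ => (Function.update q.1 x q.2, q.1 x))
              (fun q _ => (Function.update q.1 x q.2, q.1 x)) ?_ ?_ ?_ ?_ ?_ <;> simp
        _ = _ := by
            rw [Fintype.sum_prod_type]
            simp [Finset.mul_sum]
    rw [Finset.card_insert_of_notMem hx, pow_succ, pow_succ]
    calc (D.card : ℝ) ^ Y.card * D.card * ∑ f, a f
        = (D.card : ℝ) ^ Y.card * ∑ f, D.card * a f := by rw [← Finset.mul_sum]; ring
      _ ≤ _ := h1
      _ ≤ (Fintype.card κ : ℝ) ^ Y.card * ((Fintype.card κ : ℝ) * ∑ f, b f) := by gcongr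
      _ = _ := by ring

def sfGood {β ι : Type*} [DecidableEq β] (H : Finset ι) (s : ι → Finset β) (W : Finset β)
    (w : ℕ) (i : ι) : Prop := ∃ j ∈ H, s j \ W ⊆ s i ∧ (s j \ W).card ≤ w

def sfCol {β κ : Type*} [Fintype β] [DecidableEq κ] (S : Finset κ) (f : β → κ) : Finset β :=
  Finset.univ.filter (fun x => f x ∈ S)

open Classical in
theorem sf_step {β κ ι : Type*} [Fintype β] [DecidableEq β] [Fintype κ] [DecidableEq κ]
    (H : Finset ι) (s : ι → Finset β) (S D : Finset κ) (hSD : Disjoint S D) (w w' : ℕ) (M : ℝ)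
    (hM : ∀ B : Finset β, B.card ≤ w →
      ∑ A ∈ B.powerset.filter (fun A => w' < A.card), ((H.filter (fun i => A ⊆ s i)).card : ℝ) ≤ M) :
    (D.card : ℝ) ^ w * ∑ f : β → κ, ((H.filter (fun i => sfGood H s (sfCol S f) w i ∧
        ¬ sfGood H s (sfCol (S ∪ D) f) w' i)).card : ℝ) ≤
      (Fintype.card κ : ℝ) ^ w * ∑ _f : β → κ, M := by
  have hB : ∀ W Z : Finset β, ∃ B : Finset β, B.card ≤ w ∧
      ((∃ j ∈ H, s j \ W ⊆ Z ∧ (s j \ W).card ≤ w) → ∃ j ∈ H, B = s j \ W ∧ B ⊆ Z) := by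
    intro W Z
    by_cases h : ∃ j ∈ H, s j \ W ⊆ Z ∧ (s j \ W).card ≤ w
    · obtain ⟨j, hj, h1, h2⟩ := h
      exact ⟨s j \ W, h2, fun _ => ⟨j, hj, rfl, h1⟩⟩
    · exact ⟨∅, by simp, fun h' => absurd h' h⟩
  choose B hBc hBp using hB
  let cand : Finset β → (β → κ) → ι → Prop := fun W f i =>
    ∃ A ⊆ B W (sfCol D f), w' < A.card ∧ A ⊆ s i
  have key : ∀ (W : Finset β) (i : ι),
      (D.card : ℝ) ^ w * ∑ f : β → κ, (if W = sfCol S f then (if sfGood H s (sfCol S f) w i ∧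
        ¬ sfGood H s (sfCol (S ∪ D) f) w' i then (1:ℝ) else 0) else 0) ≤
      (Fintype.card κ : ℝ) ^ w * ∑ f : β → κ,
        (if W = sfCol S f then (if cand (sfCol S f) f i then (1:ℝ) else 0) else 0) := by
    intro W i
    have hnn : 0 ≤ ∑ f : β → κ,
        (if W = sfCol S f then (if cand (sfCol S f) f i then (1:ℝ) else 0) else 0) :=
      Finset.sum_nonneg (fun f _ => by split_ifs <;> norm_num)
    by_cases hg : sfGood H s W w i
    · obtain ⟨j0, hj0, hsub, hcard⟩ := hg
      have h1 := sf_recolor D (s j0 \ W)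
        (fun f => (if W = sfCol S f then (if sfGood H s (sfCol S f) w i ∧
          ¬ sfGood H s (sfCol (S ∪ D) f) w' i then (1:ℝ) else 0) else 0))
        (fun f => (if W = sfCol S f then (if cand (sfCol S f) f i then (1:ℝ) else 0) else 0))
        (fun f => by split_ifs <;> norm_num) (by
          intro f f' hout hin
          by_cases hW : W = sfCol S f
          swap
          · simp only [if_neg hW]; split_ifs <;> norm_num
          by_cases hb : sfGood H s (sfCol S f) w i ∧ ¬ sfGood H s (sfCol (S ∪ D) f) w' i
          swap
          · simp only [if_neg hb]; split_ifs <;> norm_num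
          have hW' : W = sfCol S f' := by
            rw [hW]
            ext x
            simp only [sfCol, Finset.mem_filter, Finset.mem_univ, true_and]
            by_cases hx : x ∈ s j0 \ W
            · have h1 : f' x ∉ S := fun h => Finset.disjoint_left.mp hSD h (hin x hx)
              have h2 : f x ∉ S := by
                intro h
                rw [Finset.mem_sdiff, hW] at hx
                exact hx.2 (by simp [sfCol, h])
              simp [h1, h2]
            · rw [hout x hx]
          have hY : s j0 \ W ⊆ sfCol D f' := by
            intro x hx
            simp [sfCol, hin x hx]
          have hc : cand (sfCol S f') f' i := by
            rw [← hW']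
            obtain ⟨j, hj, hBj, hBZ⟩ := hBp W (sfCol D f') ⟨j0, hj0, hY, hcard⟩
            have hsub2 : s j \ sfCol (S ∪ D) f ⊆ s j \ W := by
              intro x hx
              rw [Finset.mem_sdiff] at hx ⊢
              refine ⟨hx.1, fun h => hx.2 ?_⟩
              rw [hW] at h
              simp only [sfCol, Finset.mem_filter, Finset.mem_univ, true_and, Finset.mem_union] at h ⊢
              exact Or.inl h
            have hAi : s j \ sfCol (S ∪ D) f ⊆ s i := by
              intro x hx
              apply hsub
              by_contra hxY
              have h1 := hBZ (hBj ▸ hsub2 hx)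
              simp only [sfCol, Finset.mem_filter, Finset.mem_univ, true_and] at h1
              rw [hout x hxY] at h1
              rw [Finset.mem_sdiff] at hx
              apply hx.2
              simp [sfCol, h1]
            refine ⟨s j \ sfCol (S ∪ D) f, hBj ▸ hsub2, ?_, hAi⟩
            by_contra hlt
            exact hb.2 ⟨j, hj, hAi, not_lt.mp hlt⟩
          rw [if_pos hW, if_pos hb, if_pos hW', if_pos hc])
      have hdN : (D.card : ℝ) ≤ Fintype.card κ := by exact_mod_cast Finset.card_le_univ D
      obtain ⟨e, he⟩ := Nat.exists_eq_add_of_le hcard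
      have hp1 : (D.card : ℝ) ^ w = (D.card : ℝ) ^ e * (D.card : ℝ) ^ (s j0 \ W).card := by
        rw [← pow_add, add_comm, ← he]
      have hp2 : (Fintype.card κ : ℝ) ^ w =
          (Fintype.card κ : ℝ) ^ e * (Fintype.card κ : ℝ) ^ (s j0 \ W).card := by
        rw [← pow_add, add_comm, ← he]
      rw [hp1, hp2, mul_assoc, mul_assoc]
      calc _ ≤ (D.card : ℝ) ^ e * _ := mul_le_mul_of_nonneg_left h1 (by positivity)
        _ ≤ _ := mul_le_mul_of_nonneg_right (pow_le_pow_left₀ (by positivity) hdN e)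
            (mul_nonneg (by positivity) hnn)
    · have : ∑ f : β → κ, (if W = sfCol S f then (if sfGood H s (sfCol S f) w i ∧
        ¬ sfGood H s (sfCol (S ∪ D) f) w' i then (1:ℝ) else 0) else 0) = 0 := by
        apply Finset.sum_eq_zero
        intro f _
        split_ifs with h1 h2
        · exact absurd (h1 ▸ h2.1) hg
        · rfl
        · rfl
      rw [this, mul_zero]
      exact mul_nonneg (by positivity) hnn
  have hL : ∀ (Q : (β → κ) → ι → Prop) [∀ f i, Decidable (Q f i)], ∑ i ∈ H, ∑ W : Finset β, ∑ f : β → κ,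
      (if W = sfCol S f then (if Q f i then (1:ℝ) else 0) else 0) =
      ∑ f : β → κ, ((H.filter (fun i => Q f i)).card : ℝ) := by
    intro Q _
    calc _ = ∑ i ∈ H, ∑ f : β → κ, (if Q f i then (1:ℝ) else 0) := by
          refine Finset.sum_congr rfl (fun i _ => ?_)
          rw [Finset.sum_comm]
          simp
      _ = _ := by
          rw [Finset.sum_comm]
          simp
  have hsum := Finset.sum_le_sum (s := H) (fun i _ => Finset.sum_le_sum
    (s := (Finset.univ : Finset (Finset β))) (fun W _ => key W i))
  simp only [← Finset.mul_sum] at hsum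
  rw [hL (fun f i => sfGood H s (sfCol S f) w i ∧ ¬ sfGood H s (sfCol (S ∪ D) f) w' i),
    hL (fun f i => cand (sfCol S f) f i)] at hsum
  refine hsum.trans (mul_le_mul_of_nonneg_left (Finset.sum_le_sum fun f _ => ?_) (by positivity))
  refine le_trans ?_ (hM (B (sfCol S f) (sfCol D f)) (hBc _ _))
  have : H.filter (fun i => cand (sfCol S f) f i) ⊆
      ((B (sfCol S f) (sfCol D f)).powerset.filter (fun A => w' < A.card)).biUnion
        (fun A => H.filter (fun i => A ⊆ s i)) := by
    intro i hi
    rw [Finset.mem_filter] at hi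
    obtain ⟨hi, A, hA, hc, hs⟩ := hi
    simp only [Finset.mem_biUnion, Finset.mem_filter, Finset.mem_powerset]
    exact ⟨A, ⟨hA, hc⟩, hi, hs⟩
  exact_mod_cast (Finset.card_le_card this).trans Finset.card_biUnion_le

open Classical in
theorem sf_core {β ι : Type*} [Fintype β] [DecidableEq β]
    (H : Finset ι) (s : ι → Finset β) (n t r k : ℕ) (hr : 1 ≤ r) (hk : 1 ≤ k) (htk : t < 2 ^ k)
    (hcard : ∀ i ∈ H, (s i).card ≤ n)
    (h1 : ∀ A : Finset β, t < A.card → (H.filter (fun i => A ⊆ s i)).card ≤ 1)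
    (h2 : ∀ A : Finset β, A.card ≤ t →
      ((H.filter (fun i => A ⊆ s i)).card : ℝ) * ((4 * r * k : ℝ) ^ 2) ^ A.card ≤ H.card)
    (hbig : (r : ℝ) * (4 * r) ^ n < 3 / 4 * H.card) :
    ∃ g : Fin r → ι, (∀ p, g p ∈ H) ∧ ∀ p q, p ≠ q → Disjoint (s (g p)) (s (g q)) := by
  have hrR : (1:ℝ) ≤ r := by exact_mod_cast hr
  have hkR : (1:ℝ) ≤ k := by exact_mod_cast hk
  have hHpos : (0:ℝ) < H.card := by
    have : (0:ℝ) < (r : ℝ) * (4 * r) ^ n := by positivity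
    linarith
  have hN : (Fintype.card (Fin r × Fin (2 * k)) : ℝ) = 2 * r * k := by
    simp; ring
  let S : Fin r → ℕ → Finset (Fin r × Fin (2 * k)) := fun p j => Finset.univ.filter (fun q => q.1 = p ∧ q.2.1 < k + j)
  obtain ⟨T, hT⟩ : ∃ T : ℝ, T = ∑ _f : β → (Fin r × Fin (2 * k)), (1:ℝ) := ⟨_, rfl⟩
  have hTM : ∀ M : ℝ, ∑ _f : β → (Fin r × Fin (2 * k)), M = T * M := by
    intro M; simp [hT]
  have hTpos : 0 < T := by
    have : Nonempty (β → (Fin r × Fin (2 * k))) := ⟨fun _ => (⟨0, by omega⟩, ⟨0, by omega⟩)⟩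
    simp only [hT, Finset.sum_const, nsmul_eq_mul, mul_one]
    exact_mod_cast Finset.card_pos.mpr Finset.univ_nonempty
  let E : Fin r → ℕ → ℝ := fun p j => ∑ f : β → (Fin r × Fin (2 * k)),
    ((H.filter (fun i => ¬ sfGood H s (sfCol (S p j) f) (t / 2 ^ j) i)).card : ℝ)
  have hE0 : ∀ p, E p 0 ≤ T * (4 * r) ^ n := by
    intro p
    have hst := sf_step H s (∅ : Finset (Fin r × Fin (2 * k))) (S p 0) (by simp) n t (2 ^ n) (by
      intro B hB
      calc _ ≤ ∑ A ∈ B.powerset.filter (fun A => t < A.card), (1:ℝ) := by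
            apply Finset.sum_le_sum
            intro A hA
            exact_mod_cast h1 A (Finset.mem_filter.mp hA).2
        _ = ((B.powerset.filter (fun A => t < A.card)).card : ℝ) := by simp
        _ ≤ (B.powerset.card : ℝ) := by exact_mod_cast Finset.card_filter_le _ _
        _ = 2 ^ B.card := by simp
        _ ≤ 2 ^ n := pow_le_pow_right₀ (by norm_num) hB)
    have hScard : ((S p 0).card : ℝ) = k := by
      have : S p 0 = ({p} : Finset (Fin r)) ×ˢ
          (Finset.univ.filter (fun q : Fin (2 * k) => q.1 < k)) := by
        ext ⟨a, b⟩
        simp only [S, Finset.mem_filter, Finset.mem_univ, true_and, Finset.mem_product,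
          Finset.mem_singleton, add_zero]
      rw [this, Finset.card_product, Fin.card_filter_val_lt]
      rw [Finset.card_singleton, one_mul, min_eq_right (by omega)]
    rw [hScard, hN, hTM] at hst
    have hEe : E p 0 = ∑ f : β → (Fin r × Fin (2 * k)), ((H.filter (fun i => sfGood H s (sfCol ∅ f) n i ∧
        ¬ sfGood H s (sfCol (∅ ∪ S p 0) f) t i)).card : ℝ) := by
      refine Finset.sum_congr rfl (fun f _ => ?_)
      congr 2
      apply Finset.filter_congr
      intro i hi
      have : sfGood H s (sfCol (∅ : Finset (Fin r × Fin (2 * k))) f) n i :=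
        ⟨i, hi, Finset.sdiff_subset, (Finset.card_le_card Finset.sdiff_subset).trans (hcard i hi)⟩
      simp [this]
    rw [← hEe] at hst
    have hkn : (0:ℝ) < (k:ℝ) ^ n := by positivity
    have : (k:ℝ) ^ n * E p 0 ≤ (k:ℝ) ^ n * (T * (4 * r) ^ n) := by
      refine hst.trans (le_of_eq ?_)
      rw [show (4 * r : ℝ) = 2 * r * 2 by ring, mul_pow (2 * r : ℝ) k, mul_pow (2 * r : ℝ) 2]
      ring
    exact le_of_mul_le_mul_left this hkn
  have hEs : ∀ p j, j < k → E p (j + 1) ≤ E p j + T * (H.card / (4 * r * k)) := by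
    intro p j hj
    set w := t / 2 ^ j with hw
    have hw' : t / 2 ^ (j + 1) = w / 2 := by rw [hw, pow_succ, Nat.div_div_eq_div_mul]
    have hwt : w ≤ t := Nat.div_le_self _ _
    let D : Finset (Fin r × Fin (2 * k)) := {(p, ⟨k + j, by omega⟩)}
    have hX : (1:ℝ) ≤ 4 * r * k := by nlinarith
    have hst := sf_step H s (S p j) D (by simp [S, D]) w (w / 2)
      (2 ^ w * (H.card / ((4 * r * k : ℝ) ^ 2) ^ (w / 2 + 1))) (by
      intro B hB
      calc _ ≤ ∑ A ∈ B.powerset.filter (fun A => w / 2 < A.card),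
              (H.card / ((4 * r * k : ℝ) ^ 2) ^ (w / 2 + 1)) := by
            apply Finset.sum_le_sum
            intro A hA
            rw [Finset.mem_filter, Finset.mem_powerset] at hA
            have hAt : A.card ≤ t := ((Finset.card_le_card hA.1).trans hB).trans hwt
            rw [le_div_iff₀ (by positivity)]
            refine le_trans ?_ (h2 A hAt)
            exact mul_le_mul_of_nonneg_left (pow_le_pow_right₀ (one_le_pow₀ hX) hA.2)
              (Nat.cast_nonneg _)
        _ = ((B.powerset.filter (fun A => w / 2 < A.card)).card : ℝ) * 
              (H.card / ((4 * r * k : ℝ) ^ 2) ^ (w / 2 + 1)) := by simp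
        _ ≤ (2 ^ w : ℝ) * (H.card / ((4 * r * k : ℝ) ^ 2) ^ (w / 2 + 1)) := by
            refine mul_le_mul_of_nonneg_right ?_ (div_nonneg hHpos.le (pow_nonneg (sq_nonneg _) _))
            calc ((B.powerset.filter (fun A => w / 2 < A.card)).card : ℝ)
                ≤ (B.powerset.card : ℝ) := by exact_mod_cast Finset.card_filter_le _ _
              _ = 2 ^ B.card := by simp
              _ ≤ 2 ^ w := pow_le_pow_right₀ (by norm_num) hB)
    have hSD : S p j ∪ D = S p (j + 1) := by
      ext ⟨a, b⟩
      simp only [S, D, Finset.mem_union, Finset.mem_filter, Finset.mem_univ, true_and,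
        Finset.mem_singleton, Prod.ext_iff, Fin.ext_iff]
      omega
    rw [hSD, hN, hTM] at hst
    simp only [D, Finset.card_singleton, Nat.cast_one, one_pow, one_mul] at hst
    have hbound : (2 * r * k : ℝ) ^ w * (T * (2 ^ w * (H.card / ((4 * r * k : ℝ) ^ 2) ^ (w / 2 + 1))))
        ≤ T * (H.card / (4 * r * k)) := by
      have e1 : (2 * r * k : ℝ) ^ w * (T * (2 ^ w * (H.card / ((4 * r * k : ℝ) ^ 2) ^ (w / 2 + 1))))
        = T * (H.card * ((4 * r * k : ℝ) ^ w / ((4 * r * k : ℝ) ^ 2) ^ (w / 2 + 1))) := by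
        rw [show (4 * r * k : ℝ) ^ w = (2 * r * k : ℝ) ^ w * 2 ^ w by rw [← mul_pow]; ring_nf]
        ring
      rw [e1, div_eq_mul_inv (H.card : ℝ)]
      refine mul_le_mul_of_nonneg_left (mul_le_mul_of_nonneg_left ?_ hHpos.le) hTpos.le
      rw [div_le_iff₀ (by positivity), ← pow_mul, inv_mul_eq_div, le_div_iff₀ (by positivity),
        ← pow_succ]
      exact pow_le_pow_right₀ hX (by omega)
    refine le_trans ?_ (add_le_add_right (hst.trans hbound) _)
    simp only [E]
    rw [← Finset.sum_add_distrib]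
    apply Finset.sum_le_sum
    intro f _
    rw [hw', ← hw]
    have : H.filter (fun i => ¬ sfGood H s (sfCol (S p (j + 1)) f) (w / 2) i) ⊆
        H.filter (fun i => ¬ sfGood H s (sfCol (S p j) f) w i) ∪
        H.filter (fun i => sfGood H s (sfCol (S p j) f) w i ∧
          ¬ sfGood H s (sfCol (S p (j + 1)) f) (w / 2) i) := by
      intro i hi
      simp only [Finset.mem_union, Finset.mem_filter] at hi ⊢
      tauto
    exact_mod_cast (Finset.card_le_card this).trans (Finset.card_union_le _ _)
  have hEj : ∀ p j, j ≤ k → E p j ≤ T * (4 * r) ^ n + j * (T * (H.card / (4 * r * k))) := by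
    intro p j
    induction j with
    | zero => intro _; simpa using hE0 p
    | succ j ih =>
      intro hj
      have := hEs p j (by omega)
      have := ih (by omega)
      push_cast
      linarith
  let failSet : Fin r → Finset (β → (Fin r × Fin (2 * k))) := fun p =>
    Finset.univ.filter (fun f => ¬ ∃ i ∈ H, s i ⊆ sfCol (S p k) f)
  have hfail : ∀ p, ((failSet p).card : ℝ) * H.card ≤ E p k := by
    intro p
    calc ((failSet p).card : ℝ) * H.card = ∑ f ∈ failSet p, (H.card : ℝ) := by simp
      _ ≤ ∑ f ∈ failSet p, ((H.filter (fun i => ¬ sfGood H s (sfCol (S p k) f) (t / 2 ^ k) i)).card : ℝ) := by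
          apply Finset.sum_le_sum
          intro f hf
          rw [Finset.filter_true_of_mem]
          rintro i hi ⟨j, hj, _, hc⟩
          rw [Nat.div_eq_of_lt htk, Nat.le_zero, Finset.card_eq_zero,
            Finset.sdiff_eq_empty_iff_subset] at hc
          exact (Finset.mem_filter.mp hf).2 ⟨j, hj, hc⟩
      _ ≤ E p k := Finset.sum_le_sum_of_subset_of_nonneg (Finset.subset_univ _)
          (fun _ _ _ => Nat.cast_nonneg _)
  have hex : ∃ f : β → (Fin r × Fin (2 * k)), ∀ p, f ∉ failSet p := by
    by_contra hcon
    push Not at hcon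
    have hu : (Finset.univ : Finset (β → (Fin r × Fin (2 * k)))) ⊆ Finset.univ.biUnion failSet := by
      intro f _
      obtain ⟨p, hp⟩ := hcon f
      exact Finset.mem_biUnion.mpr ⟨p, Finset.mem_univ _, hp⟩
    have hc : T ≤ ∑ p, ((failSet p).card : ℝ) := by
      have := (Finset.card_le_card hu).trans Finset.card_biUnion_le
      simp only [hT, Finset.sum_const, nsmul_eq_mul, mul_one]
      exact_mod_cast this
    have h3 : T * H.card ≤ ∑ p : Fin r, (T * (4 * r) ^ n + k * (T * (H.card / (4 * r * k)))) := by
      calc T * H.card ≤ (∑ p, ((failSet p).card : ℝ)) * H.card := mul_le_mul_of_nonneg_right hc hHpos.le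
        _ = ∑ p, ((failSet p).card : ℝ) * H.card := by rw [Finset.sum_mul]
        _ ≤ _ := Finset.sum_le_sum (fun p _ => (hfail p).trans (hEj p k le_rfl))
    rw [Finset.sum_const, Finset.card_univ, Fintype.card_fin, nsmul_eq_mul] at h3
    have h4 : (r : ℝ) * (T * (4 * r) ^ n + k * (T * (H.card / (4 * r * k)))) =
        T * (r * (4 * r) ^ n + H.card / 4) := by
      generalize (H.card : ℝ) = h
      clear * - hrR hkR
      field_simp
    rw [h4] at h3
    have := le_of_mul_le_mul_left h3 hTpos
    linarith
  obtain ⟨f, hf⟩ := hex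
  have : ∀ p, ∃ i ∈ H, s i ⊆ sfCol (S p k) f := by
    intro p
    have := hf p
    simp only [failSet, Finset.mem_filter, Finset.mem_univ, true_and, not_not] at this
    exact this
  choose g hg hgs using this
  refine ⟨g, hg, fun p q hpq => ?_⟩
  rw [Finset.disjoint_left]
  intro x hx hy
  have h5 := hgs p hx
  have h6 := hgs q hy
  simp only [sfCol, S, Finset.mem_filter, Finset.mem_univ, true_and] at h5 h6
  exact hpq (h5.1.symm.trans h6.1)

theorem sf_mid {α : Type*} [DecidableEq α] (F : Finset (Finset α)) (n t r k : ℕ)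
    (hr : 1 ≤ r) (hk : 1 ≤ k) (htk : t < 2 ^ k) (htn : t < n)
    (hF : ∀ A ∈ F, A.card = n)
    (hinter : ∀ A ∈ F, ∀ B ∈ F, A ≠ B → (A ∩ B).card ≤ t)
    (hb1 : (((4 * r * k : ℝ) ^ 2) ^ t) ^ 2 ≤ F.card)
    (hb2 : (r : ℝ) * (4 * r) ^ n * ((4 * r * k : ℝ) ^ 2) ^ t < 3 / 4 * F.card) :
    HasSunflower F r := by
  have hrR : (1:ℝ) ≤ r := by exact_mod_cast hr
  have hkR : (1:ℝ) ≤ k := by exact_mod_cast hk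
  have hR1 : (1:ℝ) ≤ (4 * r * k : ℝ) ^ 2 := one_le_pow₀ (by nlinarith)
  generalize hRdef : (4 * r * k : ℝ) ^ 2 = R at *
  have hR0 : 0 < R := by linarith
  let X : Finset α := F.biUnion id
  let N : Finset α → ℝ := fun S => ((F.filter (fun B => S ⊆ B)).card : ℝ)
  obtain ⟨S, hS, hmax⟩ := Finset.exists_max_image (X.powerset.filter (fun S => S.card ≤ t))
    (fun S => N S * R ^ S.card) ⟨∅, by simp⟩
  rw [Finset.mem_filter, Finset.mem_powerset] at hS
  obtain ⟨H, hH⟩ : ∃ H, H = F.filter (fun B => S ⊆ B) := ⟨_, rfl⟩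
  have hNS : N S = H.card := by rw [hH]
  have hcnt : (F.card : ℝ) ≤ H.card * R ^ t := by
    have h0 := hmax ∅ (by simp)
    simp only [Finset.card_empty, pow_zero, mul_one, hNS] at h0
    have h1 : N ∅ = F.card := by simp [N]
    rw [← h1]
    exact h0.trans (mul_le_mul_of_nonneg_left (pow_le_pow_right₀ hR1 hS.2) (Nat.cast_nonneg _))
  have hRt : 0 < R ^ t := pow_pos hR0 t
  have hHR : R ^ t ≤ H.card := by
    have : R ^ t * R ^ t ≤ H.card * R ^ t := by
      rw [← sq]; exact hb1.trans hcnt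
    exact le_of_mul_le_mul_right this hRt
  let s : Finset α → Finset X := fun B => (B \ S).subtype (· ∈ X)
  have hmem : ∀ B ∈ F, B ⊆ X := fun B hB x hx => Finset.mem_biUnion.mpr ⟨B, hB, hx⟩
  have hsA : ∀ (A : Finset X) (B : Finset α), A ⊆ s B →
      A.map (Function.Embedding.subtype _) ⊆ B \ S := by
    intro A B hA x hx
    obtain ⟨y, hy, rfl⟩ := Finset.mem_map.mp hx
    have := hA hy
    simp only [s, Finset.mem_subtype] at this
    exact this
  have hle1 : ∀ (A : Finset X) (A' : Finset α), t < A'.card →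
      (∀ B ∈ H, A ⊆ s B → A' ⊆ B) → (H.filter (fun i => A ⊆ s i)).card ≤ 1 := by
    intro A A' ht hA
    rw [Finset.card_le_one]
    intro B hB B' hB'
    rw [Finset.mem_filter] at hB hB'
    by_contra hne
    have h3 : A' ⊆ B ∩ B' := Finset.subset_inter (hA B hB.1 hB.2) (hA B' hB'.1 hB'.2)
    have h4 := Finset.card_le_card h3
    have h5 := hinter B (by rw [hH] at hB; exact (Finset.mem_filter.mp hB.1).1) B'
      (by rw [hH] at hB'; exact (Finset.mem_filter.mp hB'.1).1) hne
    omega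
  have hHF : ∀ B ∈ H, B ∈ F ∧ S ⊆ B := by
    intro B hB; rw [hH] at hB; exact Finset.mem_filter.mp hB
  obtain ⟨g, hg, hdis⟩ := sf_core H s n t r k hr hk htk (by
      intro B hB
      rw [Finset.card_subtype]
      refine (Finset.card_filter_le _ _).trans ?_
      exact (Finset.card_le_card Finset.sdiff_subset).trans (hF B (hHF B hB).1).le) (by
      intro A hA
      convert hle1 A (A.map (Function.Embedding.subtype _)) (by simpa using hA)
        (fun B _ h => (hsA A B h).trans Finset.sdiff_subset)) (by
      intro A hA
      rw [hRdef]
      suffices hh : ((H.filter (fun i => A ⊆ s i)).card : ℝ) * R ^ A.card ≤ H.card by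
        convert hh
      rcases (H.filter (fun i => A ⊆ s i)).eq_empty_or_nonempty with he | ⟨B0, hB0⟩
      · rw [he]; simp
      rw [Finset.mem_filter] at hB0
      have hdj : Disjoint S (A.map (Function.Embedding.subtype _)) := by
        rw [Finset.disjoint_left]
        intro x hx hx'
        exact (Finset.mem_sdiff.mp (hsA A B0 hB0.2 hx')).2 hx
      have hcU : (S ∪ A.map (Function.Embedding.subtype _)).card = S.card + A.card := by
        rw [Finset.card_union_of_disjoint hdj, Finset.card_map]
      have hUs : ∀ B ∈ H, A ⊆ s B → S ∪ A.map (Function.Embedding.subtype _) ⊆ B :=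
        fun B hB h => Finset.union_subset (hHF B hB).2 ((hsA A B h).trans Finset.sdiff_subset)
      by_cases hU : (S ∪ A.map (Function.Embedding.subtype _)).card ≤ t
      · have h6 := hmax (S ∪ A.map (Function.Embedding.subtype _)) (by
          rw [Finset.mem_filter, Finset.mem_powerset]
          exact ⟨(hUs B0 hB0.1 hB0.2).trans (hmem B0 (hHF B0 hB0.1).1), hU⟩)
        simp only [hcU, hNS] at h6
        have h7 : ((H.filter (fun i => A ⊆ s i)).card : ℝ) ≤
            N (S ∪ A.map (Function.Embedding.subtype _)) := by
          simp only [N]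
          norm_cast
          apply Finset.card_le_card
          intro B hB
          rw [Finset.mem_filter] at hB ⊢
          exact ⟨(hHF B hB.1).1, hUs B hB.1 hB.2⟩
        have h8 : 0 < R ^ S.card := pow_pos hR0 _
        refine le_of_mul_le_mul_right ?_ h8
        refine le_trans ?_ h6
        rw [pow_add, mul_assoc, mul_comm (R ^ A.card)]
        exact mul_le_mul_of_nonneg_right h7 (mul_pos h8 (pow_pos hR0 _)).le
      · have h7 : ((H.filter (fun i => A ⊆ s i)).card : ℝ) ≤ 1 := by
          exact_mod_cast hle1 A _ (not_le.mp hU) hUs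
        calc _ ≤ 1 * R ^ A.card := mul_le_mul_of_nonneg_right h7 (pow_pos hR0 _).le
          _ = R ^ A.card := one_mul _
          _ ≤ R ^ t := pow_le_pow_right₀ hR1 hA
          _ ≤ _ := hHR) (by
      refine lt_of_mul_lt_mul_right ?_ hRt.le
      calc _ < 3 / 4 * (F.card : ℝ) := hb2
        _ ≤ 3 / 4 * (H.card * R ^ t) := by linarith
        _ = _ := by ring)
  have hdisj : ∀ p q, p ≠ q → g p ∩ g q = S := by
    intro p q hpq
    apply Finset.Subset.antisymm
    · intro x hx
      rw [Finset.mem_inter] at hx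
      by_contra hxS
      have hxX : x ∈ X := hmem _ (hHF _ (hg p)).1 hx.1
      have hd := Finset.disjoint_left.mp (hdis p q hpq)
      refine @hd ⟨x, hxX⟩ ?_ ?_
      · simp [s, hx.1, hxS]
      · simp [s, hx.2, hxS]
    · exact Finset.subset_inter (hHF _ (hg p)).2 (hHF _ (hg q)).2
  have hinj : Function.Injective g := by
    intro p q hpq
    by_contra hne
    have h9 := hdisj p q hne
    rw [← hpq, Finset.inter_self] at h9
    have := hF _ (hHF _ (hg p)).1
    rw [h9] at this
    omega
  refine ⟨Finset.univ.image g, ?_, ?_, S, ?_⟩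
  · intro B hB
    obtain ⟨p, _, rfl⟩ := Finset.mem_image.mp hB
    exact (hHF _ (hg p)).1
  · rw [Finset.card_image_of_injective _ hinj]; simp
  · intro A hA B hB hAB
    obtain ⟨p, _, rfl⟩ := Finset.mem_image.mp hA
    obtain ⟨q, _, rfl⟩ := Finset.mem_image.mp hB
    exact hdisj p q (fun h => hAB (by rw [h]))

/-- for any C > 1 there is c = c(r) > 0 such that every n-uniform,
r-sunflower-free family with |F| ≥ (C·4r)^n and 3 ≤ r ≤ log n has two members
intersecting in at least c·n/log log n elements. -/
theorem sunflower_free_large_intersection (C : ℝ) (hC : C > 1) (r : ℕ) :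
    ∃ c : ℝ, c > 0 ∧ ∀ (α : Type) [DecidableEq α], ∀ (n : ℕ),
      ∀ F : Finset (Finset α),
      (∀ A ∈ F, A.card = n) → ¬ HasSunflower F r →
      (F.card : ℝ) ≥ (C * 4 * r) ^ n →
      3 ≤ r → (r : ℝ) ≤ Real.log n →
      ∃ F₁ ∈ F, ∃ F₂ ∈ F, F₁ ≠ F₂ ∧
        c * n / Real.log (Real.log n) ≤ ((F₁ ∩ F₂).card : ℝ) := by
  have hl : 0 < Real.log C := Real.log_pos hC
  obtain ⟨l, hldef⟩ : ∃ l, l = Real.log C := ⟨_, rfl⟩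
  rw [← hldef] at hl
  refine ⟨min (1 / 2) (min (l / 16) (l ^ 2 / 16)), by positivity, ?_⟩
  generalize hc : min (1 / 2) (min (l / 16) (l ^ 2 / 16)) = c
  have hc0 : 0 < c := by rw [← hc]; positivity
  have hc1 : c ≤ 1 / 2 := by rw [← hc]; exact min_le_left _ _
  have hc2 : c ≤ l / 16 := by
    rw [← hc]; exact (min_le_right _ _).trans (min_le_left _ _)
  have hc3 : c ≤ l ^ 2 / 16 := by
    rw [← hc]; exact (min_le_right _ _).trans (min_le_right _ _)
  intro α _ n F hF hsf hcard hr hrn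
  by_contra hcon
  push Not at hcon
  apply hsf
  have hrR : (3:ℝ) ≤ r := by exact_mod_cast hr
  have hL3 : 3 ≤ Real.log n := hrR.trans hrn
  generalize hLdef : Real.log n = L at *
  have hn0 : 0 < n := by
    rcases Nat.eq_zero_or_pos n with h | h
    · rw [h] at hLdef; simp at hLdef; linarith
    · exact h
  have hnR : (0:ℝ) < n := by exact_mod_cast hn0
  have hnL : (n : ℝ) = Real.exp L := by rw [← hLdef, Real.exp_log hnR]
  have hLn : L ≤ n := by rw [hnL]; linarith [Real.add_one_le_exp L]
  have hll : 1 ≤ Real.log L := by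
    rw [Real.le_log_iff_exp_le (by linarith)]
    have := Real.exp_one_lt_d9
    linarith
  have hCexp : C = Real.exp l := by rw [hldef, Real.exp_log (by linarith)]
  have hFexp : Real.exp (l * n) * (4 * r) ^ n ≤ F.card := by
    have : (C * 4 * r) ^ n = Real.exp (l * n) * (4 * r) ^ n := by
      rw [mul_assoc, mul_pow, hCexp, ← Real.exp_nat_mul, mul_comm l]
    rw [← this]; exact hcard
  have h4rn : (1:ℝ) ≤ (4 * r) ^ n := one_le_pow₀ (by linarith)
  by_cases hsmall : c * n / Real.log L < 1
  · skip
    have hrF : r ≤ F.card := by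
      have : (r : ℝ) ≤ F.card := by
        calc (r:ℝ) ≤ 4 * r := by linarith
          _ ≤ (4 * r) ^ n := le_self_pow₀ (by linarith) (by omega)
          _ ≤ Real.exp (l * n) * (4 * r) ^ n :=
              le_mul_of_one_le_left (by positivity) (Real.one_le_exp (by positivity))
          _ ≤ _ := hFexp
      exact_mod_cast this
    obtain ⟨P, hP, hPc⟩ := Finset.exists_subset_card_eq hrF
    refine ⟨P, hP, hPc, ∅, fun A hA B hB hAB => ?_⟩
    have h1 := (hcon A (hP hA) B (hP hB) hAB).trans hsmall
    have h2 : (A ∩ B).card < 1 := by exact_mod_cast h1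
    rw [← Finset.card_eq_zero]; omega
  · rw [not_lt, le_div_iff₀ (by linarith), one_mul] at hsmall
    have htle : (⌊c * n / Real.log L⌋₊ : ℝ) ≤ c * n / Real.log L := Nat.floor_le (by positivity)
    have hinter : ∀ A ∈ F, ∀ B ∈ F, A ≠ B → (A ∩ B).card ≤ ⌊c * n / Real.log L⌋₊ :=
      fun A hA B hB hAB => Nat.le_floor (hcon A hA B hB hAB).le
    generalize ⌊c * n / Real.log L⌋₊ = t at htle hinter
    rw [le_div_iff₀ (by linarith)] at htle
    have htn : t < n := by
      have : (t:ℝ) < n := by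
        have : (t:ℝ) ≤ t * Real.log L := le_mul_of_one_le_right (by positivity) hll
        nlinarith
      exact_mod_cast this
    have hkb : ((Nat.log 2 n + 1 : ℕ) : ℝ) ≤ 2 * L := by
      have h1 : ((2 ^ Nat.log 2 n : ℕ) : ℝ) ≤ n := by
        exact_mod_cast Nat.pow_log_le_self 2 (by omega)
      have h2 := Real.log_le_log (by positivity) h1
      rw [hLdef] at h2
      push_cast at h2 ⊢
      rw [Real.log_pow] at h2
      have := Real.log_two_gt_d9
      have h3 : (Nat.log 2 n : ℝ) * 0.6 ≤ L := by
        refine le_trans (mul_le_mul_of_nonneg_left ?_ (by positivity)) h2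
        linarith
      linarith
    have hnk : n < 2 ^ (Nat.log 2 n + 1) := Nat.lt_pow_succ_log_self (by norm_num) n
    have hk1 : 1 ≤ Nat.log 2 n + 1 := by omega
    generalize Nat.log 2 n + 1 = k at hkb hnk hk1
    have hkR : (1:ℝ) ≤ k := by exact_mod_cast hk1
    have hRle : ((4 * r * k : ℝ) ^ 2) ≤ Real.exp (8 * Real.log L) := by
      have e1 : Real.exp (8 * Real.log L) = (L ^ 4) ^ 2 := by
        have e2 := Real.exp_nat_mul (Real.log L) 8
        rw [Real.exp_log (by linarith)] at e2
        rw [← pow_mul]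
        exact_mod_cast e2
      rw [e1]
      apply pow_le_pow_left₀ (by positivity)
      calc (4 * r * k : ℝ) ≤ 4 * L * (2 * L) := by gcongr
        _ = 8 * L ^ 2 := by ring
        _ ≤ L ^ 2 * L ^ 2 := mul_le_mul_of_nonneg_right (by nlinarith) (by positivity)
        _ = L ^ 4 := by ring
    have hRt : ((4 * r * k : ℝ) ^ 2) ^ t ≤ Real.exp (l * n / 2) := by
      calc ((4 * r * k : ℝ) ^ 2) ^ t ≤ Real.exp (8 * Real.log L) ^ t := by gcongr
        _ = Real.exp (8 * (t * Real.log L)) := by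
            rw [← Real.exp_nat_mul]; congr 1; ring
        _ ≤ Real.exp (l * n / 2) := by
            apply Real.exp_le_exp.mpr
            nlinarith
    have hhalf : Real.exp (l * n) = Real.exp (l * n / 2) * Real.exp (l * n / 2) := by
      rw [← Real.exp_add]; congr 1; ring
    refine sf_mid F n t r k (by omega) hk1 (htn.trans hnk) htn hF hinter ?_ ?_
    · calc (((4 * r * k : ℝ) ^ 2) ^ t) ^ 2 ≤ Real.exp (l * n / 2) ^ 2 := by gcongr
        _ = Real.exp (l * n) := by rw [hhalf]; ring
        _ ≤ Real.exp (l * n) * (4 * r) ^ n := le_mul_of_one_le_right (by positivity) h4rn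
        _ ≤ _ := hFexp
    · have hre : (r : ℝ) < 3 / 4 * Real.exp (l * n / 2) := by
        have h1 : 1 + l * n / 2 + (l * n / 2) ^ 2 / 2 ≤ Real.exp (l * n / 2) :=
          Real.quadratic_le_exp_of_nonneg (by positivity)
        have h2 : 1 ≤ c * n := hll.trans hsmall
        have h3 : 1 ≤ l ^ 2 / 16 * n := h2.trans (by gcongr)
        have h4 : (n:ℝ) ≤ (l ^ 2 / 16 * n) * n := le_mul_of_one_le_left hnR.le h3
        have h5 : 0 < l * n := by positivity
        nlinarith
      calc (r : ℝ) * (4 * r) ^ n * ((4 * r * k : ℝ) ^ 2) ^ t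
          ≤ (r : ℝ) * (4 * r) ^ n * Real.exp (l * n / 2) := by gcongr
        _ = (4 * r) ^ n * Real.exp (l * n / 2) * r := by ring
        _ < (4 * r) ^ n * Real.exp (l * n / 2) * (3 / 4 * Real.exp (l * n / 2)) := by gcongr
        _ = 3 / 4 * (Real.exp (l * n) * (4 * r) ^ n) := by rw [hhalf]; ring
        _ ≤ _ := by gcongr
end
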